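/- arXiv:2109.13106 — 2 statements merged into one kernel-verified Lean document; each statement's English description precedes it below -/
import Mathlib

section
/- Let 0 ≤ λ < d be integers and let μ₁, …, μ_{λ+1} be finite measures on ℝ^d. Then there exists an affine subspace L of ℝ^d of dimension λ such that L is a λ-transversal for each μᵢ: every closed half-space of ℝ^d containing L has μᵢ-measure at least μᵢ(ℝ^d)/(d+1−λ), for each i = 1, …, λ+1. -/
open MeasureTheory Module
open scoped RealInnerProductSpace ENNReal

namespace BorsukUlam

section Cochains

variable {V : Type*}

/-- The `j`-th face of a sequence of vertices: omit the entry of index `j`. -/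
def face (j : ℕ) (v : ℕ → V) : ℕ → V := fun i => v (if i < j then i else i + 1)

/-- The cup product of the coboundaries of the labels `s 0, …, s (n - 1)`, evaluated on the
simplex `v 0, …, v n`. -/
def cup (s : ℕ → V → ZMod 2) (n : ℕ) (v : ℕ → V) : ZMod 2 :=
  ∏ i ∈ Finset.range n, (s i (v i) + s i (v (i + 1)))

/-- The cup product of the coboundaries of the labels `s i`, `i < k + q + 1`, in which the factor
of index `k` is replaced by the label `s k` itself. -/
def cupWith (q : ℕ) : ℕ → (ℕ → V → ZMod 2) → (ℕ → V) → ZMod 2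
  | 0, s, v => s 0 (v 0) * cup (fun i => s (i + 1)) q v
  | k + 1, s, v =>
    (s 0 (v 0) + s 0 (v 1)) * cupWith q k (fun i => s (i + 1)) (fun i => v (i + 1))

theorem cup_succ (s : ℕ → V → ZMod 2) (n : ℕ) (v : ℕ → V) :
    cup s (n + 1) v =
      (s 0 (v 0) + s 0 (v 1)) * cup (fun i => s (i + 1)) n (fun i => v (i + 1)) := by
  simp [cup, Finset.prod_range_succ', mul_comm]

theorem face_zero (v : ℕ → V) : face 0 v = fun i => v (i + 1) := by
  ext i; simp [face]

theorem face_succ_zero (j : ℕ) (v : ℕ → V) : face (j + 1) v 0 = v 0 := by simp [face]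

theorem shift_face_succ (j : ℕ) (v : ℕ → V) :
    (fun i => face (j + 1) v (i + 1)) = face j (fun i => v (i + 1)) := by
  ext i
  by_cases h : i < j <;> simp [face, h]

theorem sum_mul_face (s : V → ZMod 2) (B : (ℕ → V) → ZMod 2) (m : ℕ) (v : ℕ → V) :
    ∑ j ∈ Finset.range (m + 2),
        (s (face j v 0) + s (face j v 1)) * B (fun i => face j v (i + 1)) =
      (s (v 0) + s (v 1)) * ∑ j ∈ Finset.range (m + 1), B (face j (fun i => v (i + 1))) := by
  have h1 : ∀ j, face (j + 1 + 1) v 1 = v 1 := fun j => by simp [face]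
  have h2 : face 1 v 1 = v 2 := by simp [face]
  rw [Finset.sum_range_succ', Finset.sum_range_succ', Finset.sum_range_succ' _ m]
  simp only [face_succ_zero, shift_face_succ, h1, zero_add, h2, face_zero]
  rw [← Finset.mul_sum]
  have := CharTwo.add_self_eq_zero (s (v 2))
  linear_combination (B fun i => v (i + 1 + 1)) * this

theorem sum_cup_face (n : ℕ) (s : ℕ → V → ZMod 2) (v : ℕ → V) :
    ∑ j ∈ Finset.range (n + 2), cup s n (face j v) = 0 := by
  induction n generalizing s v with
  | zero => simp [cup, CharTwo.two_eq_zero]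
  | succ n ih =>
    simp only [cup_succ]
    rw [sum_mul_face (s 0) (cup (fun i => s (i + 1)) n) (n + 1) v, ih, mul_zero]

theorem sum_cupWith_face (q k : ℕ) (s : ℕ → V → ZMod 2) (v : ℕ → V) :
    ∑ j ∈ Finset.range (k + q + 2), cupWith q k s (face j v) = cup s (k + q + 1) v := by
  induction k generalizing s v with
  | zero =>
    have h := sum_cup_face q (fun i => s (i + 1)) v
    rw [Finset.sum_range_succ'] at h
    rw [zero_add, Finset.sum_range_succ']
    simp only [cupWith, face_succ_zero, ← Finset.mul_sum, cup_succ, face_zero, zero_add] at h ⊢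
    linear_combination s 0 (v 0) * h -
      (s 0 (v 0) * cup (fun i => s (i + 1)) q fun i => v (i + 1)) *
        CharTwo.two_eq_zero (R := ZMod 2)
  | succ k ih =>
    simp only [cupWith]
    rw [show k + 1 + q + 2 = k + q + 1 + 2 by ring, sum_mul_face (s 0), ih,
      show k + 1 + q + 1 = k + q + 1 + 1 by ring, cup_succ s (k + q + 1)]

theorem cup_congr (n : ℕ) (s : ℕ → V → ZMod 2) (v v' : ℕ → V)
    (h : ∀ i < n, ∀ a ≤ n, ∀ b ≤ n, s i (v a) + s i (v b) = s i (v' a) + s i (v' b)) :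
    cup s n v = cup s n v' := by
  refine Finset.prod_congr rfl fun i hi => ?_
  have := Finset.mem_range.1 hi
  exact h i this _ (by lia) _ (by lia)

theorem cupWith_congr (q k : ℕ) (s : ℕ → V → ZMod 2) (v v' : ℕ → V)
    (hk : ∀ a ≤ k + q, s k (v a) = s k (v' a))
    (h : ∀ i < k + q + 1, ∀ a ≤ k + q, ∀ b ≤ k + q,
      s i (v a) + s i (v b) = s i (v' a) + s i (v' b)) :
    cupWith q k s v = cupWith q k s v' := by
  induction k generalizing s v v' with
  | zero =>
    simp only [cupWith]
    rw [hk 0 (by lia), cup_congr q _ v v']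
    intro i hi a ha b hb
    exact h _ (by lia) _ (by lia) _ (by lia)
  | succ k ih =>
    simp only [cupWith]
    rw [h 0 (by lia) 0 (by lia) 1 (by lia), ih]
    · intro a ha
      exact hk _ (by lia)
    · intro i hi a ha b hb
      exact h _ (by lia) _ (by lia) _ (by lia)

theorem cup_update (n k : ℕ) (hk : k < n) (s : ℕ → V → ZMod 2) (w : V → ZMod 2) (v : ℕ → V) :
    cup (Function.update s k w) n v + cup s n v = cup (Function.update s k (w + s k)) n v := by
  have key : ∀ t : V → ZMod 2, cup (Function.update s k t) n v =
      (t (v k) + t (v (k + 1))) *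
        ∏ i ∈ (Finset.range n).erase k, (s i (v i) + s i (v (i + 1))) := by
    intro t
    rw [cup, ← Finset.mul_prod_erase _ _ (Finset.mem_range.2 hk)]
    congr 1
    · simp
    · refine Finset.prod_congr rfl fun i hi => ?_
      rw [Function.update_of_ne (Finset.ne_of_mem_erase hi)]
  have h := key (s k)
  rw [Function.update_eq_self] at h
  rw [key, key, h]
  simp only [Pi.add_apply]
  ring

end Cochains

section Grid

variable {n L : ℕ}

/-- The maximal simplices of the barycentric subdivision of the grid `{0, …, 2 * L} ^ n` with
cells of side `2`: a cell, a vertex of this cell, and an order of the coordinates. -/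
abbrev Simplex (n L : ℕ) : Type := (Fin n → Fin L) × (Fin n → Bool) × Equiv.Perm (Fin n)

/-- The `k`-th vertex of a simplex: the coordinates in position `< k` have been moved from the
chosen vertex of the cell to the centre of the cell. -/
def Simplex.vert (σ : Simplex n L) (k : ℕ) (c : Fin n) : ℕ :=
  if (σ.2.2 c : ℕ) < k then 2 * σ.1 c + 1 else 2 * σ.1 c + 2 * (σ.2.1 c).toNat

/-- Reflect the coordinates in the block `b` of a point of the grid `{0, …, 2 * L} ^ n`. -/
def reflect (L : ℕ) {ι : Type*} [DecidableEq ι] (blk : Fin n → ι) (b : ι) (v : Fin n → ℕ) :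
    Fin n → ℕ :=
  fun c => if blk c = b then 2 * L - v c else v c

theorem Simplex.vert_le (σ : Simplex n L) (k : ℕ) (c : Fin n) : σ.vert k c ≤ 2 * L := by
  have h1 := (σ.1 c).2
  have h2 := Bool.toNat_le (σ.2.1 c)
  unfold Simplex.vert
  split_ifs <;> lia

/-- Flip the chosen vertex of the cell in the coordinate at the position `0`. -/
def Simplex.flipFirst (σ : Simplex (n + 1) L) : Simplex (n + 1) L :=
  (σ.1, Function.update σ.2.1 (σ.2.2.symm 0) (!σ.2.1 (σ.2.2.symm 0)), σ.2.2)

theorem Simplex.flipFirst_flipFirst (σ : Simplex (n + 1) L) : σ.flipFirst.flipFirst = σ := by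
  simp [Simplex.flipFirst]

theorem Simplex.flipFirst_ne (σ : Simplex (n + 1) L) : σ.flipFirst ≠ σ := by
  intro h
  have := congrFun (congrArg (fun τ => τ.2.1) h) (σ.2.2.symm 0)
  simp [Simplex.flipFirst] at this

theorem Simplex.vert_flipFirst (σ : Simplex (n + 1) L) (k : ℕ) (hk : 0 < k) :
    σ.flipFirst.vert k = σ.vert k := by
  ext c
  by_cases hc : c = σ.2.2.symm 0
  · subst hc
    simp [Simplex.flipFirst, Simplex.vert, hk]
  · simp [Simplex.flipFirst, Simplex.vert, hc]

/-- Exchange two positions. -/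
def Simplex.swapPos (i j : Fin n) (σ : Simplex n L) : Simplex n L :=
  (σ.1, σ.2.1, σ.2.2.trans (Equiv.swap i j))

theorem Simplex.swapPos_swapPos (i j : Fin n) (σ : Simplex n L) :
    (σ.swapPos i j).swapPos i j = σ := by
  ext <;> simp [Simplex.swapPos]

theorem Simplex.swapPos_ne {i j : Fin n} (hij : i ≠ j) (σ : Simplex n L) :
    σ.swapPos i j ≠ σ := by
  intro h
  have := congrArg (fun τ : Simplex n L => τ.2.2 (σ.2.2.symm i)) h
  simp [Simplex.swapPos, hij.symm] at this

theorem Simplex.vert_swapPos (i j : Fin n) (hij : (j : ℕ) = i + 1) (σ : Simplex n L) (k : ℕ)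
    (hk : k ≠ j) : (σ.swapPos i j).vert k = σ.vert k := by
  ext c
  have h : ((Equiv.swap i j (σ.2.2 c) : Fin n) : ℕ) < k ↔ (σ.2.2 c : ℕ) < k := by
    rw [Equiv.swap_apply_def]
    split_ifs with h1 h2
    · rw [h1]; lia
    · rw [h2]; lia
    · rfl
  simp [Simplex.vert, Simplex.swapPos, h]

/-- The coordinate in the last position. -/
def Simplex.lastCoord (σ : Simplex (n + 1) L) : Fin (n + 1) := σ.2.2.symm (Fin.last n)

/-- The facet opposite to the centre of the cell is contained in the boundary of the grid. -/
def Simplex.IsBoundary (σ : Simplex (n + 1) L) : Prop :=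
  (σ.2.1 σ.lastCoord = true ∧ (σ.1 σ.lastCoord : ℕ) + 1 = L) ∨
    (σ.2.1 σ.lastCoord = false ∧ (σ.1 σ.lastCoord : ℕ) = 0)

/-- The simplex reflected in a block of coordinates. -/
def Simplex.reflect {ι : Type*} [DecidableEq ι] (blk : Fin n → ι) (b : ι) (σ : Simplex n L) :
    Simplex n L :=
  (fun c => if blk c = b then (σ.1 c).rev else σ.1 c,
    fun c => if blk c = b then !σ.2.1 c else σ.2.1 c, σ.2.2)

theorem Simplex.vert_reflect {ι : Type*} [DecidableEq ι] (blk : Fin n → ι) (b : ι)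
    (σ : Simplex n L) (k : ℕ) :
    (σ.reflect blk b).vert k = BorsukUlam.reflect L blk b (σ.vert k) := by
  ext c
  have h1 := (σ.1 c).2
  by_cases hb : blk c = b
  · simp only [Simplex.vert, Simplex.reflect, BorsukUlam.reflect, hb, if_true, Fin.val_rev]
    cases σ.2.1 c <;> simp <;> split_ifs <;> lia
  · simp [Simplex.vert, Simplex.reflect, BorsukUlam.reflect, hb]

/-- The cell on the other side of the facet opposite to the centre of the cell. -/
def Simplex.adjacent (σ : Simplex (n + 1) L) : Simplex (n + 1) L :=
  (Function.update σ.1 σ.lastCoord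
    ⟨if σ.2.1 σ.lastCoord then (σ.1 σ.lastCoord + 1) % L else σ.1 σ.lastCoord - 1, by
      have := (σ.1 σ.lastCoord).2
      split_ifs
      · exact Nat.mod_lt _ (by lia)
      · lia⟩,
    Function.update σ.2.1 σ.lastCoord (!σ.2.1 σ.lastCoord), σ.2.2)

theorem Simplex.lastCoord_reflect {ι : Type*} [DecidableEq ι] (blk : Fin (n + 1) → ι) (b : ι)
    (σ : Simplex (n + 1) L) : (σ.reflect blk b).lastCoord = σ.lastCoord := rfl

theorem Simplex.adjacent_ne (σ : Simplex (n + 1) L) : σ.adjacent ≠ σ := by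
  intro h
  have := congrFun (congrArg (fun τ => τ.2.1) h) σ.lastCoord
  simp [Simplex.adjacent] at this

theorem Simplex.adjacent_adjacent (σ : Simplex (n + 1) L) (hσ : ¬ σ.IsBoundary) :
    σ.adjacent.adjacent = σ := by
  have h1 := (σ.1 σ.lastCoord).2
  have key : σ.adjacent.adjacent.1 = σ.1 := by
    funext c
    by_cases hc : c = σ.lastCoord
    · subst hc
      apply Fin.ext
      simp only [Simplex.IsBoundary] at hσ
      cases he : σ.2.1 σ.lastCoord
      · simp only [he] at hσ
        simp only [Simplex.adjacent, Simplex.lastCoord] at he h1 hσ ⊢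
        simp [he]
        rw [Nat.mod_eq_of_lt] <;> grind
      · simp only [he] at hσ
        simp only [Simplex.adjacent, Simplex.lastCoord] at he h1 hσ ⊢
        simp [he]
        rw [Nat.mod_eq_of_lt] <;> grind
    · simp only [Simplex.adjacent, Simplex.lastCoord] at hc ⊢
      simp [hc]
  refine Prod.ext key (Prod.ext ?_ rfl)
  simp only [Simplex.adjacent, Simplex.lastCoord]
  simp

theorem Simplex.isBoundary_adjacent (σ : Simplex (n + 1) L) (hσ : ¬ σ.IsBoundary) :
    ¬ σ.adjacent.IsBoundary := by
  have h1 := (σ.1 σ.lastCoord).2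
  simp only [Simplex.IsBoundary] at hσ ⊢
  cases he : σ.2.1 σ.lastCoord
  · simp only [he] at hσ
    simp only [Simplex.adjacent, Simplex.lastCoord] at he h1 hσ ⊢
    simp [he]
    grind
  · simp only [he] at hσ
    simp only [Simplex.adjacent, Simplex.lastCoord] at he h1 hσ ⊢
    simp [he]
    rw [Nat.mod_eq_of_lt] <;> grind

theorem Simplex.vert_adjacent (σ : Simplex (n + 1) L) (hσ : ¬ σ.IsBoundary) (k : ℕ)
    (hk : k ≤ n) : σ.adjacent.vert k = σ.vert k := by
  have h1 := (σ.1 σ.lastCoord).2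
  ext c
  by_cases hc : c = σ.lastCoord
  · subst hc
    simp only [Simplex.IsBoundary] at hσ
    cases he : σ.2.1 σ.lastCoord
    · simp only [he] at hσ
      simp only [Simplex.adjacent, Simplex.lastCoord, Simplex.vert] at he h1 hσ ⊢
      simp [he]
      grind
    · simp only [he] at hσ
      simp only [Simplex.adjacent, Simplex.lastCoord, Simplex.vert] at he h1 hσ ⊢
      simp [he]
      rw [Nat.mod_eq_of_lt] <;> grind
  · simp only [Simplex.adjacent, Simplex.lastCoord, Simplex.vert] at hc ⊢
    simp [hc]

theorem Simplex.isBoundary_reflect {ι : Type*} [DecidableEq ι] (blk : Fin (n + 1) → ι) (b : ι)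
    (σ : Simplex (n + 1) L) (hb : blk σ.lastCoord = b) :
    (σ.reflect blk b).IsBoundary ↔ σ.IsBoundary := by
  have h1 := (σ.1 σ.lastCoord).2
  simp only [Simplex.IsBoundary, Simplex.lastCoord_reflect]
  simp only [Simplex.reflect, hb, if_true, Fin.val_rev]
  cases σ.2.1 σ.lastCoord <;> simp <;> lia

theorem Simplex.vert_lastCoord (σ : Simplex (n + 1) L) (hσ : σ.IsBoundary) :
    (∀ k ≤ n, σ.vert k σ.lastCoord = 0) ∨ ∀ k ≤ n, σ.vert k σ.lastCoord = 2 * L := by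
  rcases hσ with ⟨h1, h2⟩ | ⟨h1, h2⟩
  · right
    intro k hk
    simp only [Simplex.vert, h1]
    simp [Simplex.lastCoord] at h2 ⊢
    lia
  · left
    intro k hk
    simp only [Simplex.vert, h1, h2]
    simp [Simplex.lastCoord]
    lia

open Classical in
/-- The other simplex with the same facet opposite to the centre of the cell, where the facets in
the boundary are glued by the reflections of the blocks. -/
noncomputable def Simplex.across {ι : Type*} [DecidableEq ι] (blk : Fin (n + 1) → ι)
    (σ : Simplex (n + 1) L) : Simplex (n + 1) L :=
  if σ.IsBoundary then σ.reflect blk (blk σ.lastCoord) else σ.adjacent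

theorem Simplex.across_across {ι : Type*} [DecidableEq ι] (blk : Fin (n + 1) → ι)
    (σ : Simplex (n + 1) L) : (σ.across blk).across blk = σ := by
  by_cases h : σ.IsBoundary
  · rw [Simplex.across, Simplex.across, if_pos h, Simplex.lastCoord_reflect,
      if_pos ((Simplex.isBoundary_reflect blk _ σ rfl).2 h)]
    simp only [Simplex.reflect]
    refine Prod.ext (funext fun c => ?_) (Prod.ext (funext fun c => ?_) rfl) <;>
    by_cases hc : blk c = blk σ.lastCoord <;> simp [hc]
  · rw [Simplex.across, Simplex.across, if_neg h, if_neg (σ.isBoundary_adjacent h),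
      σ.adjacent_adjacent h]

theorem Simplex.across_ne {ι : Type*} [DecidableEq ι] (blk : Fin (n + 1) → ι)
    (σ : Simplex (n + 1) L) : σ.across blk ≠ σ := by
  by_cases h : σ.IsBoundary
  · rw [Simplex.across, if_pos h]
    intro h'
    have := congrFun (congrArg (fun τ => τ.2.1) h') σ.lastCoord
    simp [Simplex.reflect] at this
  · rw [Simplex.across, if_neg h]
    exact σ.adjacent_ne

theorem sum_eq_zero_of_involution {α : Type*} [Fintype α] (f : α → ZMod 2) (g : α → α)
    (hf : ∀ a, f (g a) = f a) (hne : ∀ a, g a ≠ a) (hg : ∀ a, g (g a) = a) :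
    ∑ a, f a = 0 :=
  Finset.sum_ninvolution g (fun a => by rw [hf, CharTwo.add_self_eq_zero]) (fun a _ => hne a)
    (fun a => Finset.mem_univ _) hg

/-- The sum of a cochain over the boundary of the grid vanishes when the cochain is invariant
under the reflections which glue opposite facets. -/
theorem sum_face_vert {ι : Type*} [DecidableEq ι] (blk : Fin (n + 1) → ι)
    (ω : (ℕ → Fin (n + 1) → ℕ) → ZMod 2)
    (hdep : ∀ v v', (∀ i ≤ n, v i = v' i) → ω v = ω v')
    (hrefl : ∀ v c, (∀ i c, v i c ≤ 2 * L) →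
      ((∀ i ≤ n, v i c = 0) ∨ (∀ i ≤ n, v i c = 2 * L)) →
      ω (fun i => reflect L blk (blk c) (v i)) = ω v) :
    ∑ σ : Simplex (n + 1) L, ∑ j ∈ Finset.range (n + 2), ω (face j σ.vert) = 0 := by
  rw [Finset.sum_comm]
  refine Finset.sum_eq_zero fun j hj => ?_
  have hj := Finset.mem_range.1 hj
  rcases Nat.eq_zero_or_pos j with rfl | hj0
  · refine sum_eq_zero_of_involution _ Simplex.flipFirst (fun σ => ?_) Simplex.flipFirst_ne
      Simplex.flipFirst_flipFirst
    refine hdep _ _ fun i _ => ?_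
    simp [face, Simplex.vert_flipFirst]
  rcases (Nat.lt_succ_iff.1 hj).lt_or_eq with hjn | rfl
  · refine sum_eq_zero_of_involution _ (Simplex.swapPos ⟨j - 1, by lia⟩ ⟨j, hjn⟩) (fun σ => ?_)
      (Simplex.swapPos_ne (by simp; lia)) (Simplex.swapPos_swapPos _ _)
    refine hdep _ _ fun i _ => ?_
    refine Simplex.vert_swapPos _ _ (by simp; lia) _ _ ?_
    simp only
    split_ifs <;> lia
  · refine sum_eq_zero_of_involution _ (Simplex.across blk) (fun σ => ?_)
      (Simplex.across_ne blk) (Simplex.across_across blk)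
    have hface : ∀ v : ℕ → Fin (n + 1) → ℕ, ω (face (n + 1) v) = ω v := fun v =>
      hdep _ _ fun i hi => by simp [face, Nat.lt_succ_of_le hi]
    rw [hface, hface]
    by_cases h : σ.IsBoundary
    · rw [Simplex.across, if_pos h, ← hrefl σ.vert σ.lastCoord σ.vert_le (σ.vert_lastCoord h)]
      exact congrArg ω (funext fun i => Simplex.vert_reflect _ _ _ _)
    · rw [Simplex.across, if_neg h]
      exact hdep _ _ fun i hi => σ.vert_adjacent h i hi

end Grid

section Degree

variable {n L : ℕ} {ι : Type*} [DecidableEq ι]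

/-- A labelling of the grid `{0, …, 2 * L} ^ n` which, on the boundary of the block `b`, changes
by `a b` under the reflection of this block. -/
def IsLabelling (L : ℕ) (blk : Fin n → ι) (a : ι → ZMod 2) (f : (Fin n → ℕ) → ZMod 2) : Prop :=
  ∀ v : Fin n → ℕ, (∀ c, v c ≤ 2 * L) → ∀ c, (v c = 0 ∨ v c = 2 * L) →
    f (reflect L blk (blk c) v) = f v + a (blk c)

/-- The number modulo `2` of the simplices on which all the labels alternate. -/
noncomputable def labelDegree (L n : ℕ) (s : ℕ → (Fin n → ℕ) → ZMod 2) : ZMod 2 :=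
  ∑ σ : Simplex n L, cup s n σ.vert

theorem labelDegree_update (blk : Fin n → ι) (a : ℕ → ι → ZMod 2)
    (s : ℕ → (Fin n → ℕ) → ZMod 2) (hs : ∀ k < n, IsLabelling L blk (a k) (s k)) (k : ℕ)
    (hk : k < n) (w : (Fin n → ℕ) → ZMod 2) (hw : IsLabelling L blk (a k) w) :
    labelDegree L n (Function.update s k w) = labelDegree L n s := by
  obtain ⟨q, rfl⟩ := Nat.exists_eq_add_of_lt hk
  rw [← CharTwo.add_eq_zero, labelDegree, labelDegree, ← Finset.sum_add_distrib]
  have hsum : ∀ σ : Simplex (k + q + 1) L,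
      cup (Function.update s k w) (k + q + 1) σ.vert + cup s (k + q + 1) σ.vert =
        ∑ j ∈ Finset.range (k + q + 2),
          cupWith q k (Function.update s k (w + s k)) (face j σ.vert) := fun σ => by
    rw [cup_update _ k hk, ← sum_cupWith_face]
  simp only [hsum]
  refine sum_face_vert blk _ (fun v v' h => ?_) fun v c hv h => ?_
  · refine cupWith_congr q k _ _ _ (fun a ha => by rw [h a ha]) fun i _ a ha b hb => ?_
    rw [h a ha, h b hb]
  · have hb : ∀ i ≤ k + q, v i c = 0 ∨ v i c = 2 * L := fun i hi => by
      rcases h with h | h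
      · exact Or.inl (h i hi)
      · exact Or.inr (h i hi)
    have two := CharTwo.two_eq_zero (R := ZMod 2)
    have hk' : ∀ i ≤ k + q, (w + s k) (reflect L blk (blk c) (v i)) = (w + s k) (v i) := by
      intro i hi
      simp only [Pi.add_apply, hw _ (hv i) c (hb i hi), hs k hk _ (hv i) c (hb i hi)]
      linear_combination a k (blk c) * two
    refine cupWith_congr q k _ _ _ (fun i hi => ?_) fun j hj i hi i' hi' => ?_
    · simpa using hk' i hi
    · by_cases hjk : j = k
      · subst hjk
        simp only [Function.update_self]
        rw [hk' i hi, hk' i' hi']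
      · simp only [Function.update_of_ne hjk]
        rw [hs j hj _ (hv i) c (hb i hi), hs j hj _ (hv i') c (hb i' hi')]
        linear_combination a j (blk c) * two

theorem labelDegree_eq (blk : Fin n → ι) (a : ℕ → ι → ZMod 2)
    (s s' : ℕ → (Fin n → ℕ) → ZMod 2) (hs : ∀ k < n, IsLabelling L blk (a k) (s k))
    (hs' : ∀ k < n, IsLabelling L blk (a k) (s' k)) :
    labelDegree L n s = labelDegree L n s' := by
  have key : ∀ k ≤ n, labelDegree L n (fun i => if i < k then s' i else s i) =
      labelDegree L n s := by
    intro k hk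
    induction k with
    | zero => simp
    | succ k ih =>
      rw [← ih (by lia), ← labelDegree_update blk a (fun i => if i < k then s' i else s i) ?_ k hk
        (s' k) (hs' k hk)]
      · congr 1
        funext i
        by_cases hik : i = k
        · simp [hik]
        · rw [Function.update_of_ne hik]
          have : i < k + 1 ↔ i < k := by lia
          simp [this]
      · intro i hi
        split_ifs
        · exact hs' i hi
        · exact hs i hi
  rw [← key n le_rfl, labelDegree, labelDegree]
  refine Finset.sum_congr rfl fun σ _ => Finset.prod_congr rfl fun i hi => ?_
  simp [Finset.mem_range.1 hi]

/-- The coordinates in the block `b` at which a point of the grid lies in the boundary. -/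
def boundaryCoords (L : ℕ) (blk : Fin n → ι) (b : ι) (v : Fin n → ℕ) : Finset (Fin n) :=
  {c | blk c = b ∧ (v c = 0 ∨ v c = 2 * L)}

/-- The label of a point of the grid given by the first coordinate in the block `b` at which the
point lies in the boundary. -/
def firstLabel (L : ℕ) (blk : Fin n → ι) (b : ι) (v : Fin n → ℕ) : ZMod 2 :=
  if h : (boundaryCoords L blk b v).Nonempty then
    if v ((boundaryCoords L blk b v).min' h) = 0 then 1 else 0
  else 0

theorem firstLabel_of_isLeast {blk : Fin n → ι} {b : ι} {v : Fin n → ℕ} {c : Fin n}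
    (hc : IsLeast (boundaryCoords L blk b v : Set (Fin n)) c) :
    firstLabel L blk b v = if v c = 0 then 1 else 0 := by
  have h : (boundaryCoords L blk b v).Nonempty := ⟨c, hc.1⟩
  rw [firstLabel, dif_pos h, (Finset.isLeast_min' _ h).unique hc]

theorem firstLabel_congr {blk : Fin n → ι} {b : ι} {v v' : Fin n → ℕ}
    (h : ∀ c, blk c = b → v c = v' c) : firstLabel L blk b v = firstLabel L blk b v' := by
  have hB : boundaryCoords L blk b v = boundaryCoords L blk b v' := by
    ext c
    simp only [boundaryCoords, Finset.mem_filter, Finset.mem_univ, true_and]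
    exact and_congr_right fun hc => by rw [h c hc]
  by_cases hne : (boundaryCoords L blk b v').Nonempty
  · obtain ⟨d, h1⟩ : ∃ d, IsLeast (boundaryCoords L blk b v' : Set (Fin n)) d :=
      ⟨_, Finset.isLeast_min' _ hne⟩
    have h2 := h1
    rw [← hB] at h2
    rw [firstLabel_of_isLeast h1, firstLabel_of_isLeast h2, h]
    have := h1.1
    simp only [boundaryCoords, Finset.coe_filter, Set.mem_ofPred_eq] at this
    exact this.2.1
  · rw [firstLabel, firstLabel, dif_neg hne, dif_neg (by rwa [hB])]

theorem firstLabel_reflect (hL : 0 < L) (blk : Fin n → ι) (b : ι) :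
    IsLabelling L blk (Pi.single b 1) (firstLabel L blk b) := by
  intro v hv c hc
  by_cases hb : blk c = b
  · subst hb
    have hB : boundaryCoords L blk (blk c) (reflect L blk (blk c) v) =
        boundaryCoords L blk (blk c) v := by
      ext c'
      simp only [boundaryCoords, Finset.mem_filter, Finset.mem_univ, true_and]
      refine and_congr_right fun hc' => ?_
      have := hv c'
      simp only [reflect, hc', if_true]
      lia
    have hne : (boundaryCoords L blk (blk c) v).Nonempty := ⟨c, by simp [boundaryCoords, hc]⟩
    obtain ⟨d, h1⟩ : ∃ d, IsLeast (boundaryCoords L blk (blk c) v : Set (Fin n)) d :=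
      ⟨_, Finset.isLeast_min' _ hne⟩
    have h2 := h1
    rw [← hB] at h2
    rw [firstLabel_of_isLeast h1, firstLabel_of_isLeast h2]
    have := h1.1
    simp only [boundaryCoords, Finset.coe_filter, Set.mem_ofPred_eq, Finset.mem_univ,
      true_and] at this
    obtain ⟨h3, h4⟩ := this
    rcases h4 with h4 | h4
    · simp [reflect, h3, h4, hL.ne', CharTwo.add_self_eq_zero]
    · simp [reflect, h3, h4, hL.ne']
  · rw [Pi.single_eq_of_ne hb, add_zero]
    refine firstLabel_congr fun c' hc' => ?_
    have : blk c' ≠ blk c := by rw [hc']; exact Ne.symm hb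
    simp [reflect, this]

/-- The sum of the first labels of the blocks with coefficients `a b`. -/
def sumLabel [Fintype ι] (L : ℕ) (blk : Fin n → ι) (a : ι → ZMod 2) (v : Fin n → ℕ) : ZMod 2 :=
  ∑ b, a b * firstLabel L blk b v

theorem isLabelling_sumLabel [Fintype ι] (hL : 0 < L) (blk : Fin n → ι) (a : ι → ZMod 2) :
    IsLabelling L blk a (sumLabel L blk a) := by
  intro v hv c hc
  have h : ∀ b, firstLabel L blk b (reflect L blk (blk c) v) =
      firstLabel L blk b v + Pi.single (M := fun _ => ZMod 2) b 1 (blk c) :=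
    fun b => firstLabel_reflect hL blk b v hv c hc
  simp [sumLabel, h, mul_add, Finset.sum_add_distrib, Pi.single_apply]

theorem Simplex.vert_succ_of_ne (σ : Simplex n L) (k : Fin n) (c : Fin n)
    (hc : c ≠ σ.2.2.symm k) : σ.vert (k + 1) c = σ.vert k c := by
  have h : (σ.2.2 c : ℕ) ≠ k := fun h => hc (by rw [← Fin.ext h]; simp)
  have : (σ.2.2 c : ℕ) < k + 1 ↔ (σ.2.2 c : ℕ) < k := by lia
  simp [Simplex.vert, this]

theorem sumLabel_add_sumLabel [Fintype ι] (blk : Fin n → ι) (a : ι → ZMod 2) (σ : Simplex n L)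
    (k : Fin n) :
    sumLabel L blk a (σ.vert k) + sumLabel L blk a (σ.vert (k + 1)) =
      a (blk (σ.2.2.symm k)) * (firstLabel L blk (blk (σ.2.2.symm k)) (σ.vert k) +
        firstLabel L blk (blk (σ.2.2.symm k)) (σ.vert (k + 1))) := by
  rw [sumLabel, sumLabel, ← Finset.sum_add_distrib,
    Finset.sum_eq_single (blk (σ.2.2.symm k)) _ (by simp), mul_add]
  intro b _ hb
  rw [firstLabel_congr (v := σ.vert (k + 1)) (v' := σ.vert k), CharTwo.add_self_eq_zero]
  intro c hc
  refine σ.vert_succ_of_ne k c fun h => hb ?_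
  rw [← hc, h]

theorem isLeast_of_firstLabel_ne (blk : Fin n → ι) (σ : Simplex n L) (k : Fin n)
    (h : firstLabel L blk (blk (σ.2.2.symm k)) (σ.vert k) ≠
      firstLabel L blk (blk (σ.2.2.symm k)) (σ.vert (k + 1))) :
    IsLeast (boundaryCoords L blk (blk (σ.2.2.symm k)) (σ.vert k) : Set (Fin n))
      (σ.2.2.symm k) := by
  set c := σ.2.2.symm k with hc
  have hodd : ¬ (σ.vert (k + 1) c = 0 ∨ σ.vert (k + 1) c = 2 * L) := by
    simp [Simplex.vert, hc]
    lia
  have hmem : ∀ c' ∈ boundaryCoords L blk (blk c) (σ.vert (k + 1)),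
      c' ∈ boundaryCoords L blk (blk c) (σ.vert k) ∧ σ.vert (k + 1) c' = σ.vert k c' := by
    intro c' hc'
    have hne : c' ≠ c := by
      rintro rfl
      exact hodd (by simpa [boundaryCoords] using hc')
    rw [and_iff_left (σ.vert_succ_of_ne k c' hne)]
    simpa [boundaryCoords, σ.vert_succ_of_ne k c' hne] using hc'
  have hmem' : ∀ c' ∈ boundaryCoords L blk (blk c) (σ.vert k), c' ≠ c →
      c' ∈ boundaryCoords L blk (blk c) (σ.vert (k + 1)) := by
    intro c' hc' hne
    simpa [boundaryCoords, σ.vert_succ_of_ne k c' hne] using hc'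
  by_cases hne : (boundaryCoords L blk (blk c) (σ.vert k)).Nonempty
  · obtain ⟨d, hmin⟩ : ∃ d, IsLeast (boundaryCoords L blk (blk c) (σ.vert k) : Set (Fin n)) d :=
      ⟨_, Finset.isLeast_min' _ hne⟩
    by_cases hd : d = c
    · rwa [hd] at hmin
    · exfalso
      apply h
      have h1 := hmem' d hmin.1 hd
      have h2 : IsLeast (boundaryCoords L blk (blk c) (σ.vert (k + 1)) : Set (Fin n)) d :=
        ⟨h1, fun c' hc' => hmin.2 (hmem c' hc').1⟩
      rw [firstLabel_of_isLeast hmin, firstLabel_of_isLeast h2, (hmem d h1).2]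
  · exfalso
    apply h
    rw [firstLabel, firstLabel, dif_neg hne, dif_neg]
    rintro ⟨c', hc'⟩
    exact hne ⟨c', (hmem c' hc').1⟩

/-- A permutation which preserves the blocks and is monotone on each block is the identity. -/
theorem perm_eq_one_of_block_mono {ι : Type*} (blk : Fin n → ι) (p : Equiv.Perm (Fin n))
    (h1 : ∀ k, blk (p k) = blk k) (h2 : ∀ k k', k < k' → blk k = blk k' → p k < p k') :
    p = 1 := by
  ext k
  rw [Equiv.Perm.one_apply]
  congr 1
  induction k using WellFoundedLT.induction with
  | ind k ih =>
    by_contra hne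
    have hge : k < p k := by
      refine lt_of_le_of_ne (not_lt.1 fun hlt => hne ?_) (Ne.symm hne)
      exact p.injective (ih _ hlt)
    have hk' : p (p.symm k) = k := p.apply_symm_apply k
    have hlt : k < p.symm k := by
      refine lt_of_le_of_ne (not_lt.1 fun hlt => ?_) fun h => hne ?_
      · have := ih _ hlt
        rw [hk'] at this
        exact hlt.ne this.symm
      · conv_lhs => rw [h]
        exact hk'
    have h3 := h2 k (p.symm k) hlt (by rw [← h1 (p.symm k), hk'])
    rw [hk'] at h3
    exact lt_asymm h3 hge

/-- The number modulo `2` of the coordinates in the block `b` which are at least `k`. -/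
def tailCount (blk : Fin n → ι) (b : ι) (k : ℕ) : ZMod 2 :=
  ((Finset.univ.filter fun c : Fin n => k ≤ c ∧ blk c = b).card : ZMod 2)

theorem tailCount_succ (blk : Fin n → ι) (b : ι) (k : Fin n) :
    tailCount blk b k = tailCount blk b (k + 1) + if blk k = b then 1 else 0 := by
  have h : (Finset.univ.filter fun c : Fin n => (k : ℕ) ≤ c ∧ blk c = b) =
      (Finset.univ.filter fun c : Fin n => (k : ℕ) + 1 ≤ c ∧ blk c = b) ∪
        (Finset.univ.filter fun c : Fin n => c = k ∧ blk k = b) := by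
    ext c
    simp only [Finset.mem_filter, Finset.mem_univ, true_and, Finset.mem_union]
    constructor
    · rintro ⟨h1, h2⟩
      rcases h1.lt_or_eq with h | h
      · exact Or.inl ⟨h, h2⟩
      · have := Fin.ext h
        subst this
        exact Or.inr ⟨rfl, h2⟩
    · rintro (⟨h1, h2⟩ | ⟨rfl, h2⟩)
      · exact ⟨by lia, h2⟩
      · exact ⟨le_rfl, h2⟩
  rw [tailCount, h, Finset.card_union_of_disjoint, tailCount]
  · by_cases hb : blk k = b
    · simp [hb, Finset.filter_eq']
    · simp [hb]
  · rw [Finset.disjoint_left]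
    intro c
    simp only [Finset.mem_filter, Finset.mem_univ, true_and]
    rintro ⟨h1, _⟩ ⟨rfl, _⟩
    lia

theorem tailCount_self (blk : Fin n → ι) (b : ι) : tailCount blk b n = 0 := by
  have : ∀ c : Fin n, ¬ n ≤ c := fun c => by have := c.2; lia
  simp [tailCount, this]

end Degree

section Alternating

variable {n L m : ℕ}

theorem zmod_two_eq_one {x : ZMod 2} (hx : x ≠ 0) : x = 1 := by
  revert x; decide

/-- The only simplex on which the standard labels alternate. -/
def alternatingSimplex (hL : 0 < L) (blk : Fin n → Fin m) : Simplex n L :=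
  (fun c => if tailCount blk (blk c) c = 1 then ⟨0, hL⟩ else ⟨L - 1, by lia⟩,
    fun c => decide (tailCount blk (blk c) c ≠ 1), 1)

theorem firstLabel_of_vert (blk : Fin n → Fin m) (σ : Simplex n L)
    (hσ : σ.2.2 = 1) (hb : ∀ c, σ.vert 0 c = 0 ∨ σ.vert 0 c = 2 * L) (b : Fin m) (k : ℕ) :
    firstLabel L blk b (σ.vert k) =
      if h : (Finset.univ.filter fun c : Fin n => k ≤ c ∧ blk c = b).Nonempty then
        if σ.vert 0 (Finset.min' _ h) = 0 then 1 else 0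
      else 0 := by
  have h1 : ∀ c : Fin n, k ≤ c → σ.vert k c = σ.vert 0 c := fun c hc => by
    simp [Simplex.vert, hσ, hc]
  have hB : boundaryCoords L blk b (σ.vert k) =
      Finset.univ.filter fun c : Fin n => k ≤ c ∧ blk c = b := by
    ext c
    simp only [boundaryCoords, Finset.mem_filter, Finset.mem_univ, true_and]
    by_cases hc : k ≤ c
    · simp [h1 c hc, hb c, hc]
    · have : σ.vert k c = 2 * σ.1 c + 1 := by
        simp [Simplex.vert, hσ, lt_of_not_ge hc]
      rw [this]
      simp only [hc, false_and, iff_false, not_and]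
      lia
  by_cases h : (Finset.univ.filter fun c : Fin n => k ≤ c ∧ blk c = b).Nonempty
  · obtain ⟨d, hd⟩ : ∃ d, d = Finset.min' _ h := ⟨_, rfl⟩
    have hleast : IsLeast (boundaryCoords L blk b (σ.vert k) : Set (Fin n)) d := by
      rw [hB, hd]
      exact Finset.isLeast_min' _ h
    rw [firstLabel_of_isLeast hleast, dif_pos h, ← hd, h1]
    have := hleast.1
    rw [hB] at this
    simp only [Finset.coe_filter, Set.mem_ofPred_eq] at this
    exact this.2.1
  · rw [dif_neg h, firstLabel, dif_neg (by rwa [hB])]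

theorem vert_alternatingSimplex (hL : 0 < L) (blk : Fin n → Fin m) (c : Fin n) :
    (alternatingSimplex hL blk).vert 0 c =
      if tailCount blk (blk c) c = 1 then 0 else 2 * L := by
  by_cases h : tailCount blk (blk c) c = 1 <;> simp [Simplex.vert, alternatingSimplex, h]
  lia

theorem firstLabel_alternatingSimplex (hL : 0 < L) (blk : Fin n → Fin m) (b : Fin m) (k : ℕ) :
    firstLabel L blk b ((alternatingSimplex hL blk).vert k) = tailCount blk b k := by
  rw [firstLabel_of_vert blk _ rfl (fun c => by
    rw [vert_alternatingSimplex]; split_ifs <;> simp)]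
  by_cases h : (Finset.univ.filter fun c : Fin n => k ≤ c ∧ blk c = b).Nonempty
  · rw [dif_pos h]
    obtain ⟨d, hd⟩ : ∃ d, d = Finset.min' _ h := ⟨_, rfl⟩
    have hleast := Finset.isLeast_min' _ h
    rw [← hd] at hleast ⊢
    obtain ⟨hmem, hle⟩ := hleast
    simp only [Finset.coe_filter, Set.mem_ofPred_eq, Finset.mem_univ, true_and] at hmem
    obtain ⟨h1, rfl⟩ := hmem
    have ht : tailCount blk (blk d) d = tailCount blk (blk d) k := by
      rw [tailCount, tailCount]
      congr 2
      ext c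
      simp only [Finset.mem_filter, Finset.mem_univ, true_and]
      exact ⟨fun hc => ⟨h1.trans hc.1, hc.2⟩, fun hc => ⟨hle (by simpa using hc), hc.2⟩⟩
    rw [vert_alternatingSimplex, ht]
    by_cases h0 : tailCount blk (blk d) k = 0
    · simp [h0, hL.ne']
    · simp [zmod_two_eq_one h0]
  · rw [dif_neg h, tailCount, Finset.not_nonempty_iff_eq_empty.1 h]
    simp

theorem eq_alternatingSimplex (hL : 0 < L) (blk : Fin n → Fin m) (a : ℕ → Fin m → ZMod 2)
    (ha : ∀ (k : Fin n) b, a k b ≠ 0 → blk k ≤ b) (σ : Simplex n L)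
    (hσ : ∀ k : Fin n, sumLabel L blk (a k) (σ.vert k) +
      sumLabel L blk (a k) (σ.vert (k + 1)) ≠ 0) :
    σ = alternatingSimplex hL blk := by
  simp only [sumLabel_add_sumLabel, mul_ne_zero_iff] at hσ
  have hle : ∀ k, blk k ≤ blk (σ.2.2.symm k) := fun k => ha k _ (hσ k).1
  have hblk : ∀ k, blk (σ.2.2.symm k) = blk k := by
    have hsum : ∑ k, (blk k : ℕ) = ∑ k, (blk (σ.2.2.symm k) : ℕ) :=
      (Equiv.sum_comp σ.2.2.symm fun k => (blk k : ℕ)).symm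
    rw [Finset.sum_eq_sum_iff_of_le fun k _ => Fin.le_def.1 (hle k)] at hsum
    exact fun k => (Fin.ext (hsum k (Finset.mem_univ k))).symm
  have hne : ∀ k : Fin n, firstLabel L blk (blk (σ.2.2.symm k)) (σ.vert k) ≠
      firstLabel L blk (blk (σ.2.2.symm k)) (σ.vert (k + 1)) := fun k h =>
    (hσ k).2 (by rw [h, CharTwo.add_self_eq_zero])
  have hleast := fun k => isLeast_of_firstLabel_ne blk σ k (hne k)
  have hmem : ∀ k j : Fin n, j ≤ k →
      (σ.vert j (σ.2.2.symm k) = 0 ∨ σ.vert j (σ.2.2.symm k) = 2 * L) := by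
    intro k j hjk
    have := (hleast k).1
    simp only [boundaryCoords, Finset.coe_filter, Set.mem_ofPred_eq] at this
    have h2 : σ.vert j (σ.2.2.symm k) = σ.vert k (σ.2.2.symm k) := by
      have : ¬ (k : ℕ) < j := by have := Fin.le_def.1 hjk; lia
      simp [Simplex.vert, this]
    rw [h2]
    exact this.2.2
  have hperm : σ.2.2.symm = 1 := by
    refine perm_eq_one_of_block_mono blk _ hblk fun k k' hk hb => ?_
    refine lt_of_le_of_ne ((hleast k).2 ?_) fun h => hk.ne (σ.2.2.symm.injective h)
    simp only [boundaryCoords, Finset.coe_filter, Set.mem_ofPred_eq, Finset.mem_univ, true_and]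
    exact ⟨by rw [hblk, hblk, hb], hmem k' k hk.le⟩
  have hperm' : σ.2.2 = 1 := by
    rw [← Equiv.symm_symm σ.2.2, hperm]; rfl
  rw [hperm] at hne
  simp only [Equiv.Perm.one_apply] at hne
  have hbd : ∀ c, σ.vert 0 c = 0 ∨ σ.vert 0 c = 2 * L := by
    intro c
    have := hmem c ⟨0, by have := c.2; lia⟩ (Fin.le_def.2 (Nat.zero_le _))
    rwa [hperm] at this
  have hcount : ∀ j ≤ n, ∀ b, firstLabel L blk b (σ.vert (n - j)) = tailCount blk b (n - j) := by
    intro j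
    induction j with
    | zero =>
      intro _ b
      have : ∀ c : Fin n, ¬ n ≤ c := fun c => by have := c.2; lia
      rw [Nat.sub_zero, tailCount_self, firstLabel_of_vert blk σ hperm' hbd]
      simp [this]
    | succ j ih =>
      intro hj b
      have hk : n - j = ((⟨n - (j + 1), by lia⟩ : Fin n) : ℕ) + 1 := by simp; lia
      have ih := ih (by lia) b
      have hk' : n - (j + 1) = ((⟨n - (j + 1), by lia⟩ : Fin n) : ℕ) := rfl
      rw [hk] at ih
      rw [hk']
      generalize (⟨n - (j + 1), by lia⟩ : Fin n) = k at ih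
      rw [tailCount_succ, ← ih]
      by_cases hb : blk k = b
      · subst hb
        have h1 := hne k
        generalize firstLabel L blk (blk k) (σ.vert k) = x at h1
        generalize firstLabel L blk (blk k) (σ.vert (k + 1)) = y at h1
        simp only [if_true]
        revert x y
        decide
      · rw [if_neg hb, add_zero]
        refine firstLabel_congr fun c hc => (σ.vert_succ_of_ne k c ?_).symm
        rw [hperm]
        rintro rfl
        exact hb hc
  have hvert : ∀ c, σ.vert 0 c = (alternatingSimplex hL blk).vert 0 c := by
    intro c
    have h1 := hcount (n - c) (by lia) (blk c)
    rw [Nat.sub_sub_self c.2.le] at h1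
    have hl := hleast c
    rw [hperm] at hl
    simp only [Equiv.Perm.one_apply] at hl
    have h2 : σ.vert c c = σ.vert 0 c := by simp [Simplex.vert, hperm']
    rw [firstLabel_of_isLeast hl, h2] at h1
    rw [vert_alternatingSimplex, ← h1]
    rcases hbd c with h | h <;> simp [h, hL.ne']
  have h1 : ∀ c, σ.1 c = (alternatingSimplex hL blk).1 c ∧
      σ.2.1 c = (alternatingSimplex hL blk).2.1 c := by
    intro c
    have h1 := hvert c
    have h2 := hbd c
    simp only [Simplex.vert, Nat.not_lt_zero, if_false] at h1 h2
    generalize σ.2.1 c = e at h1 h2 ⊢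
    generalize (alternatingSimplex hL blk).2.1 c = e' at h1 h2 ⊢
    generalize σ.1 c = x at h1 h2 ⊢
    generalize (alternatingSimplex hL blk).1 c = x' at h1 h2 ⊢
    have h3 := x.2
    have h4 := x'.2
    rw [Fin.ext_iff]
    cases e <;> cases e' <;> simp at h1 h2 ⊢ <;> lia
  exact Prod.ext (funext fun c => (h1 c).1) (Prod.ext (funext fun c => (h1 c).2) hperm')

theorem labelDegree_sumLabel (hL : 0 < L) (blk : Fin n → Fin m) (a : ℕ → Fin m → ZMod 2)
    (ha : ∀ (k : Fin n) b, a k b ≠ 0 → blk k ≤ b) (ha1 : ∀ k : Fin n, a k (blk k) = 1) :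
    labelDegree L n (fun k => sumLabel L blk (a k)) = 1 := by
  rw [labelDegree, Finset.sum_eq_single (alternatingSimplex hL blk) _ (by simp)]
  · refine Finset.prod_eq_one fun k hk => ?_
    have h := sumLabel_add_sumLabel blk (a k) (alternatingSimplex hL blk)
      ⟨k, Finset.mem_range.1 hk⟩
    simp only at h
    rw [h, firstLabel_alternatingSimplex, firstLabel_alternatingSimplex]
    have h1 := ha1 ⟨k, Finset.mem_range.1 hk⟩
    have h2 := tailCount_succ blk (blk ⟨k, Finset.mem_range.1 hk⟩) ⟨k, Finset.mem_range.1 hk⟩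
    simp only at h1 h2
    have h3 : (alternatingSimplex hL blk).2.2.symm ⟨k, Finset.mem_range.1 hk⟩ =
      ⟨k, Finset.mem_range.1 hk⟩ := rfl
    rw [h3, h1, h2]
    simp only [if_true]
    generalize tailCount blk _ _ = x
    revert x
    decide
  · intro σ _ hσ
    by_contra h
    refine hσ (eq_alternatingSimplex hL blk a ha σ fun k => ?_)
    exact Finset.prod_ne_zero_iff.1 h k (Finset.mem_range.2 k.2)

/-- Some simplex is alternating for every family of labels with the given symmetries. -/
theorem exists_alternating (hL : 0 < L) (blk : Fin n → Fin m) (a : ℕ → Fin m → ZMod 2)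
    (ha : ∀ (k : Fin n) b, a k b ≠ 0 → blk k ≤ b) (ha1 : ∀ k : Fin n, a k (blk k) = 1)
    (s : ℕ → (Fin n → ℕ) → ZMod 2) (hs : ∀ k < n, IsLabelling L blk (a k) (s k)) :
    ∃ σ : Simplex n L, ∀ k < n, s k (σ.vert k) ≠ s k (σ.vert (k + 1)) := by
  have h := labelDegree_eq blk a s _ hs fun k _ => isLabelling_sumLabel hL blk (a k)
  rw [labelDegree_sumLabel hL blk a ha ha1, labelDegree] at h
  obtain ⟨σ, -, hσ⟩ := Finset.exists_ne_zero_of_sum_ne_zero (h.trans_ne one_ne_zero)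
  refine ⟨σ, fun k hk heq => Finset.prod_ne_zero_iff.1 hσ k (Finset.mem_range.2 hk) ?_⟩
  rw [heq, CharTwo.add_self_eq_zero]

end Alternating

section Continuous

open Filter Topology

variable {I : Type*} {n L m : ℕ}

/-- Change the sign of the coordinates in the block `b`. -/
def negBlock (blk : I → Fin m) (b : Fin m) (x : I → ℝ) : I → ℝ :=
  fun c => if blk c = b then -x c else x c

/-- The point of the cube `[-1, 1]ⁿ` with the given grid coordinates. -/
noncomputable def gridPoint (L : ℕ) (v : Fin n → ℕ) : Fin n → ℝ := fun c => ((v c : ℝ) - L) / L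

theorem gridPoint_reflect (blk : Fin n → Fin m) (b : Fin m) {v : Fin n → ℕ}
    (hv : ∀ c, v c ≤ 2 * L) :
    gridPoint L (reflect L blk b v) = negBlock blk b (gridPoint L v) := by
  ext c
  by_cases h : blk c = b
  · simp only [gridPoint, reflect, negBlock, h, if_true, Nat.cast_sub (hv c)]
    push_cast
    ring
  · simp [gridPoint, reflect, negBlock, h]

theorem abs_gridPoint_eq_one (hL : 0 < L) {v : Fin n → ℕ} {c : Fin n}
    (h : v c = 0 ∨ v c = 2 * L) : |gridPoint L v c| = 1 := by
  have hL' : (L : ℝ) ≠ 0 := by positivity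
  rcases h with h | h
  · simp [gridPoint, h, hL']
  · simp [gridPoint, h, hL', two_mul]

theorem abs_gridPoint_le_one (hL : 0 < L) {v : Fin n → ℕ} (hv : ∀ c, v c ≤ 2 * L) (c : Fin n) :
    |gridPoint L v c| ≤ 1 := by
  have hL' : (0 : ℝ) < L := by positivity
  have := hv c
  have h : (v c : ℝ) ≤ 2 * L := by exact_mod_cast hv c
  have h' : (0 : ℝ) ≤ v c := by positivity
  rw [gridPoint, abs_div, abs_of_pos hL', div_le_one hL', abs_le]
  constructor <;> linarith

theorem dist_gridPoint_vert (σ : Simplex n L) (k : ℕ) :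
    dist (gridPoint L (σ.vert k)) (gridPoint L (σ.vert 0)) ≤ 1 / L := by
  refine (dist_pi_le_iff (by positivity)).2 fun c => ?_
  rw [Real.dist_eq, gridPoint, gridPoint, ← sub_div, abs_div, Nat.abs_cast]
  gcongr
  rw [sub_sub_sub_cancel_right]
  have h1 : σ.vert k c ≤ σ.vert 0 c + 1 := by
    cases h : σ.2.1 c <;> simp [Simplex.vert, h] <;> split_ifs <;> lia
  have h2 : σ.vert 0 c ≤ σ.vert k c + 1 := by
    cases h : σ.2.1 c <;> simp [Simplex.vert, h] <;> split_ifs <;> lia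
  have h1 : (σ.vert k c : ℝ) ≤ σ.vert 0 c + 1 := by exact_mod_cast h1
  have h2 : (σ.vert 0 c : ℝ) ≤ σ.vert k c + 1 := by exact_mod_cast h2
  rw [abs_le]
  constructor <;> linarith

/-- The label recording the sign of `f`, with ties broken by the labelling `t`. -/
noncomputable def signLabel (L : ℕ) (f : (Fin n → ℝ) → ℝ) (t : (Fin n → ℕ) → ZMod 2)
    (v : Fin n → ℕ) : ZMod 2 :=
  if f (gridPoint L v) < 0 then 1 else if 0 < f (gridPoint L v) then 0 else t v

theorem isLabelling_signLabel (hL : 0 < L) (blk : Fin n → Fin m) (a : Fin m → ZMod 2)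
    {f : (Fin n → ℝ) → ℝ} {t : (Fin n → ℕ) → ZMod 2} (ht : IsLabelling L blk a t)
    (hf : ∀ x c, |x c| = 1 →
      f (negBlock blk (blk c) x) = (if a (blk c) = 0 then 1 else -1) * f x) :
    IsLabelling L blk a (signLabel L f t) := by
  intro v hv c hc
  have h1 := ht v hv c hc
  have h2 := hf _ c (abs_gridPoint_eq_one hL hc)
  rw [signLabel, signLabel, gridPoint_reflect blk _ hv, h2, h1]
  rcases eq_or_ne (a (blk c)) 0 with h | h
  · simp [h]
  · rw [zmod_two_eq_one h]
    rcases lt_trichotomy (f (gridPoint L v)) 0 with h0 | h0 | h0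
    · simp [h0, h0.not_gt, CharTwo.add_self_eq_zero]
    · simp [h0]
    · simp [h0, h0.not_gt]

theorem mul_nonpos_of_signLabel_ne {f : (Fin n → ℝ) → ℝ} {t : (Fin n → ℕ) → ZMod 2}
    {v w : Fin n → ℕ} (h : signLabel L f t v ≠ signLabel L f t w) :
    f (gridPoint L v) * f (gridPoint L w) ≤ 0 := by
  by_contra! h'
  rcases pos_and_pos_or_neg_and_neg_of_mul_pos h' with ⟨h1, h2⟩ | ⟨h1, h2⟩
  · exact h (by simp [signLabel, h1, h2, h1.not_gt, h2.not_gt])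
  · exact h (by simp [signLabel, h1, h2])

theorem exists_simplex_mul_nonpos (hL : 0 < L) (blk : Fin n → Fin m) (a : Fin n → Fin m → ZMod 2)
    (ha : ∀ k b, a k b ≠ 0 → blk k ≤ b) (ha1 : ∀ k, a k (blk k) = 1)
    (F : Fin n → (Fin n → ℝ) → ℝ)
    (hF : ∀ k x c, |x c| = 1 →
      F k (negBlock blk (blk c) x) = (if a k (blk c) = 0 then 1 else -1) * F k x) :
    ∃ σ : Simplex n L, ∀ k : Fin n,
      F k (gridPoint L (σ.vert k)) * F k (gridPoint L (σ.vert (k + 1))) ≤ 0 := by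
  obtain ⟨σ, hσ⟩ := exists_alternating hL blk (fun k => if h : k < n then a ⟨k, h⟩ else 0)
    (by simpa using ha) (by simpa using ha1)
    (fun k => if h : k < n then signLabel L (F ⟨k, h⟩) (sumLabel L blk (a ⟨k, h⟩)) else 0)
    (fun k hk => by
      simpa only [hk, dif_pos] using isLabelling_signLabel hL blk _
        (isLabelling_sumLabel hL blk (a ⟨k, hk⟩)) (hF ⟨k, hk⟩))
  refine ⟨σ, fun k => mul_nonpos_of_signLabel_ne (t := sumLabel L blk (a k)) ?_⟩
  simpa using hσ k k.2

theorem exists_common_zero_fin (blk : Fin n → Fin m) (a : Fin n → Fin m → ZMod 2)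
    (ha : ∀ k b, a k b ≠ 0 → blk k ≤ b) (ha1 : ∀ k, a k (blk k) = 1)
    (F : Fin n → (Fin n → ℝ) → ℝ) (hc : ∀ k, Continuous (F k))
    (hF : ∀ k x c, |x c| = 1 →
      F k (negBlock blk (blk c) x) = (if a k (blk c) = 0 then 1 else -1) * F k x) :
    ∃ x : Fin n → ℝ, (∀ c, |x c| ≤ 1) ∧ ∀ k, F k x = 0 := by
  choose σ hσ using fun L : ℕ =>
    exists_simplex_mul_nonpos (L := L + 1) L.succ_pos blk a ha ha1 F hF
  obtain ⟨x, hx, φ, hφ, hlim⟩ := (isCompact_Icc (a := (-1 : Fin n → ℝ)) (b := 1)).tendsto_subseq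
    (x := fun L => gridPoint (L + 1) ((σ L).vert 0)) fun L => by
      have := abs_gridPoint_le_one L.succ_pos ((σ L).vert_le 0)
      exact ⟨fun c => (abs_le.1 (this c)).1, fun c => (abs_le.1 (this c)).2⟩
  have hvert : ∀ k, Tendsto (fun L => gridPoint (φ L + 1) ((σ (φ L)).vert k)) atTop (𝓝 x) := by
    intro k
    refine (tendsto_iff_of_dist ?_).2 hlim
    refine squeeze_zero (fun _ => dist_nonneg) (fun L => dist_gridPoint_vert _ k) ?_
    simpa [Function.comp_def] using
      (tendsto_one_div_add_atTop_nhds_zero_nat (𝕜 := ℝ)).comp hφ.tendsto_atTop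
  refine ⟨x, fun c => abs_le.2 ⟨hx.1 c, hx.2 c⟩, fun k => mul_self_eq_zero.1 ?_⟩
  refine le_antisymm (le_of_tendsto ((((hc k).tendsto x).comp (hvert k)).mul
    (((hc k).tendsto x).comp (hvert (k + 1)))) (Eventually.of_forall fun L => hσ (φ L) k))
    (mul_self_nonneg _)

/-- A Borsuk–Ulam theorem for products of balls: functions on the cube whose restrictions to the
boundary of each block are even or odd under the antipodal map of that block, with a triangular
pattern of parities, have a common zero. -/
theorem exists_common_zero [Fintype I] (blk : I → Fin m) (a : I → Fin m → ZMod 2)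
    (ha : ∀ k b, a k b ≠ 0 → blk k ≤ b) (ha1 : ∀ k, a k (blk k) = 1)
    (F : I → (I → ℝ) → ℝ) (hc : ∀ k, Continuous (F k))
    (hF : ∀ k x c, |x c| = 1 →
      F k (negBlock blk (blk c) x) = (if a k (blk c) = 0 then 1 else -1) * F k x) :
    ∃ x : I → ℝ, (∀ c, |x c| ≤ 1) ∧ ∀ k, F k x = 0 := by
  have e := Fintype.equivFin I
  obtain ⟨x, hx, hz⟩ := exists_common_zero_fin (fun k => blk (e.symm k)) (fun k => a (e.symm k))
    (fun k => ha _) (fun k => ha1 _) (fun k y => F (e.symm k) (y ∘ e))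
    (fun k => (hc _).comp (by fun_prop)) fun k y c hy => by
      rw [← hF _ _ (e.symm c) (by simpa using hy)]
      congr 1
      ext i
      simp [negBlock]
  exact ⟨x ∘ e, fun c => hx _, fun k => by simpa using hz (e k)⟩

end Continuous
end BorsukUlam

namespace CentralTransversal

section Centerpoint

open Filter Topology

variable {E : Type*} [NormedAddCommGroup E] [InnerProductSpace ℝ E]
  {m : ℕ}

theorem isClosed_halfSpace (z : Fin m → E) (w : Fin m → ℝ) (c : ℝ) :
    IsClosed {p : E | c ≤ ∑ j, w j * ⟪p, z j⟫} :=
  isClosed_le continuous_const (by fun_prop)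

variable [MeasurableSpace E]

/-- The measure of the half-space with normal `∑ j, w j • z j` whose boundary consists of the
points with the same product with the normal as a point with `z`-coordinates `q`. -/
noncomputable def halfSpaceMass (μ : Measure E) (z : Fin m → E) (q w : Fin m → ℝ) : ℝ≥0∞ :=
  μ {p | ∑ j, w j * q j ≤ ∑ j, w j * ⟪p, z j⟫}

/-- The points of Tukey depth at least `τ` for the image of `μ` under `p ↦ (⟪p, z j⟫)ⱼ`. -/
def depthRegion (μ : Measure E) (τ : ℝ≥0∞) (z : Fin m → E) : Set (Fin m → ℝ) :=
  {q | ∀ w, τ ≤ halfSpaceMass μ z q w}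

theorem norm_le_of_mem_depthRegion {μ : Measure E} {τ : ℝ≥0∞} {z : Fin m → E} {q : Fin m → ℝ}
    {r : ℝ} (hr : μ (Metric.closedBall 0 r)ᶜ < τ) (hq : q ∈ depthRegion μ τ z) (j : Fin m) :
    |q j| ≤ r * ‖z j‖ := by
  have key : ∀ s : ℝ, |s| = 1 → s * q j ≤ r * ‖z j‖ := by
    intro s hs
    by_contra! h
    refine (hq (Pi.single j s)).not_gt ((measure_mono fun p hp => ?_).trans_lt hr)
    simp only [Pi.single_apply, ite_mul, zero_mul, Finset.sum_ite_eq', Finset.mem_univ, if_true,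
      Set.mem_ofPred_eq] at hp
    rw [Set.mem_compl_iff, mem_closedBall_zero_iff]
    intro hpr
    have h1 : s * ⟪p, z j⟫ ≤ ‖p‖ * ‖z j‖ := by
      refine (le_abs_self _).trans ?_
      rw [abs_mul, hs, one_mul]
      exact abs_real_inner_le_norm _ _
    have h2 : ‖p‖ * ‖z j‖ ≤ r * ‖z j‖ := by gcongr
    linarith
  have h1 := key 1 (by simp)
  have h2 := key (-1) (by simp)
  rw [abs_le]
  constructor <;> linarith

variable [BorelSpace E]

theorem tendsto_measure_compl_closedBall {E : Type*} [NormedAddCommGroup E] [MeasurableSpace E]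
    [BorelSpace E] (μ : Measure E) [IsFiniteMeasure μ] :
    Tendsto (fun r : ℕ => μ (Metric.closedBall 0 r)ᶜ) atTop (𝓝 0) := by
  have h := tendsto_measure_iInter_atTop (μ := μ) (s := fun r : ℕ => (Metric.closedBall (0 : E) r)ᶜ)
    (fun r => Metric.isClosed_closedBall.isOpen_compl.measurableSet.nullMeasurableSet)
    (fun r s hrs => Set.compl_subset_compl.2 (Metric.closedBall_subset_closedBall
      (Nat.cast_le.2 hrs))) ⟨0, measure_ne_top _ _⟩
  rwa [← Set.compl_iUnion, Metric.iUnion_closedBall_nat, Set.compl_univ, measure_empty] at h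

theorem exists_measure_compl_closedBall_lt {E : Type*} [NormedAddCommGroup E] [MeasurableSpace E]
    [BorelSpace E] (μ : Measure E) [IsFiniteMeasure μ] {ε : ℝ≥0∞}
    (hε : 0 < ε) : ∃ r : ℕ, μ (Metric.closedBall 0 r)ᶜ < ε :=
  ((tendsto_measure_compl_closedBall μ).eventually (gt_mem_nhds hε)).exists

theorem exists_measure_lt_of_halfSpaceMass_lt (μ : Measure E) [IsFiniteMeasure μ] {τ : ℝ≥0∞}
    {z : Fin m → E} {q w : Fin m → ℝ} (h : halfSpaceMass μ z q w < τ) :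
    ∃ c < ∑ j, w j * q j, μ {p | c ≤ ∑ j, w j * ⟪p, z j⟫} < τ := by
  set b := ∑ j, w j * q j with hb
  have hlim := tendsto_measure_iInter_atTop (μ := μ)
    (s := fun k : ℕ => {p : E | b - 1 / (k + 1) ≤ ∑ j, w j * ⟪p, z j⟫})
    (fun k => (isClosed_halfSpace z w _).measurableSet.nullMeasurableSet)
    (fun k l hkl p hp => by
      simp only [Set.mem_ofPred_eq] at hp ⊢
      have : (1 : ℝ) / (l + 1) ≤ 1 / (k + 1) := Nat.one_div_le_one_div hkl
      linarith) ⟨0, measure_ne_top _ _⟩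
  have hinter : ⋂ k : ℕ, {p : E | b - 1 / (k + 1) ≤ ∑ j, w j * ⟪p, z j⟫} =
      {p | b ≤ ∑ j, w j * ⟪p, z j⟫} := by
    ext p
    simp only [Set.mem_iInter, Set.mem_ofPred_eq]
    refine ⟨fun hp => ?_, fun hp k => ?_⟩
    · refine le_of_tendsto' (x := atTop) (f := fun k : ℕ => b - 1 / ((k : ℝ) + 1)) ?_ hp
      simpa using (tendsto_const_nhds (x := b)).sub
        (tendsto_one_div_add_atTop_nhds_zero_nat (𝕜 := ℝ))
    · have : (0 : ℝ) ≤ 1 / (k + 1) := by positivity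
      linarith
  rw [hinter] at hlim
  obtain ⟨k, hk⟩ := (hlim.eventually (gt_mem_nhds h)).exists
  exact ⟨_, sub_lt_self _ (by positivity), hk⟩

theorem depthRegion_nonempty (μ : Measure E) [IsFiniteMeasure μ] {τ : ℝ≥0∞}
    (hτ : (m + 1) * τ < μ Set.univ) (z : Fin m → E) : (depthRegion μ τ z).Nonempty := by
  obtain ⟨r, hr⟩ := exists_measure_compl_closedBall_lt μ (tsub_pos_of_lt hτ)
  obtain ⟨C, hC⟩ : ∃ C : ℝ, ∀ p : E, p ∈ Metric.closedBall (0 : E) r →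
      (fun j => ⟪p, z j⟫) ∈ Metric.closedBall (0 : Fin m → ℝ) C := by
    refine ⟨r * ∑ j, ‖z j‖, fun p hp => ?_⟩
    rw [mem_closedBall_zero_iff] at hp ⊢
    refine (pi_norm_le_iff_of_nonneg (by positivity)).2 fun j => ?_
    refine (norm_inner_le_norm p (z j)).trans ?_
    gcongr
    exact Finset.single_le_sum (f := fun j => ‖z j‖) (fun _ _ => norm_nonneg _) (Finset.mem_univ j)
  let P := {x : (Fin m → ℝ) × ℝ // μ {p | x.2 ≤ ∑ j, x.1 j * ⟪p, z j⟫} < τ}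
  let A : P → Set (Fin m → ℝ) := fun x =>
    Metric.closedBall 0 C ∩ {y | ∑ j, x.1.1 j * y j ≤ x.1.2}
  have hA : (⋂ x, A x).Nonempty := by
    refine Convex.helly_theorem_compact' (𝕜 := ℝ) (fun x => (convex_closedBall _ _).inter ?_)
      (fun x => (isCompact_closedBall _ _).inter_right (isClosed_le (by fun_prop) (by fun_prop)))
      fun J hJ => ?_
    · exact convex_halfSpace_le (f := fun y : Fin m → ℝ => ∑ j, x.1.1 j * y j)
        ⟨fun y y' => by simp [mul_add, Finset.sum_add_distrib],
          fun a y => by simp [Finset.mul_sum, mul_left_comm]⟩ _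
    · obtain ⟨p, hp⟩ : ∃ p, p ∈ Metric.closedBall (0 : E) r ∧
          ∀ x ∈ J, p ∉ {p | x.1.2 ≤ ∑ j, x.1.1 j * ⟪p, z j⟫} := by
        by_contra! hcov
        have hsub : Set.univ ⊆ (Metric.closedBall (0 : E) r)ᶜ ∪
            ⋃ x ∈ J, {p | x.1.2 ≤ ∑ j, x.1.1 j * ⟪p, z j⟫} := by
          intro p _
          by_cases hp : p ∈ Metric.closedBall (0 : E) r
          · obtain ⟨x, hx, hpx⟩ := hcov p hp
            exact Or.inr (Set.mem_biUnion hx hpx)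
          · exact Or.inl hp
        have hJm : (J.card : ℝ≥0∞) ≤ m + 1 := by
          have : J.card ≤ m + 1 := by simpa using hJ
          exact_mod_cast this
        refine lt_irrefl (μ Set.univ) ?_
        calc μ Set.univ ≤ μ (Metric.closedBall 0 r)ᶜ +
              ∑ x ∈ J, μ {p | x.1.2 ≤ ∑ j, x.1.1 j * ⟪p, z j⟫} :=
            (measure_mono hsub).trans ((measure_union_le _ _).trans
              (by gcongr; exact measure_biUnion_finset_le _ _))
          _ ≤ μ (Metric.closedBall 0 r)ᶜ + ∑ _x ∈ J, τ := by
            gcongr with x _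
            exact x.2.le
          _ ≤ μ (Metric.closedBall 0 r)ᶜ + (m + 1) * τ := by
            rw [Finset.sum_const, nsmul_eq_mul]
            gcongr
          _ < (μ Set.univ - (m + 1) * τ) + (m + 1) * τ :=
            ENNReal.add_lt_add_right hτ.ne_top hr
          _ = μ Set.univ := tsub_add_cancel_of_le hτ.le
      refine ⟨fun j => ⟪p, z j⟫, Set.mem_iInter₂.2 fun x hx => ⟨hC p hp.1, ?_⟩⟩
      have := hp.2 x hx
      rw [Set.mem_ofPred_eq, not_le] at this
      exact this.le
  obtain ⟨q, hq⟩ := hA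
  refine ⟨q, fun w => ?_⟩
  by_contra! h
  obtain ⟨c, hc, hμ⟩ := exists_measure_lt_of_halfSpaceMass_lt μ h
  exact hc.not_ge (Set.mem_iInter.1 hq ⟨(w, c), hμ⟩).2

end Centerpoint

section Selection

variable {E : Type*} [NormedAddCommGroup E] [InnerProductSpace ℝ E] [MeasurableSpace E] {m : ℕ}

theorem units_smul_mem_depthRegion {μ : Measure E} {τ : ℝ≥0∞} {z : Fin m → E} {q : Fin m → ℝ}
    (ε : Fin m → ℤˣ) (hq : q ∈ depthRegion μ τ z) : ε • q ∈ depthRegion μ τ (ε • z) := by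
  intro w
  have h : ∀ j, w j * (ε • q) j = (ε • w) j * q j := fun j => by
    rcases Int.units_eq_one_or (ε j) with h | h <;> simp [Units.smul_def, h]
  have h' : ∀ p j, w j * ⟪p, (ε • z) j⟫ = (ε • w) j * ⟪p, z j⟫ := fun p j => by
    rcases Int.units_eq_one_or (ε j) with h | h <;> simp [Units.smul_def, h]
  rw [halfSpaceMass]
  simp only [h, h']
  exact hq (ε • w)

theorem dist_units_smul {E : Type*} [NormedAddCommGroup E] (ε : Fin m → ℤˣ) (z z' : Fin m → E) :
    dist (ε • z) (ε • z') = dist z z' := by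
  simp only [dist_pi_def]
  congr 2
  ext j
  rcases Int.units_eq_one_or (ε j) with h | h <;> simp [Units.smul_def, h]

theorem units_smul_units_smul {E : Type*} [AddCommGroup E] (ε : Fin m → ℤˣ) (z : Fin m → E) :
    ε • ε • z = z := by
  ext j
  rcases Int.units_eq_one_or (ε j) with h | h <;> simp [Units.smul_def, h]

/-- The points that are averages of deep points for frames near `z`. -/
def nearDepthRegion (μ : Measure E) (τ : ℝ≥0∞) (δ : ℝ) (z : Fin m → E) : Set (Fin m → ℝ) :=
  convexHull ℝ (⋃ z' ∈ Metric.ball z δ, depthRegion μ τ z')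

theorem units_smul_mem_nearDepthRegion {μ : Measure E} {τ : ℝ≥0∞} {δ : ℝ} {z : Fin m → E}
    {q : Fin m → ℝ} (ε : Fin m → ℤˣ) (hq : q ∈ nearDepthRegion μ τ δ (ε • z)) :
    ε • q ∈ nearDepthRegion μ τ δ z := by
  let f : (Fin m → ℝ) →ₗ[ℝ] Fin m → ℝ :=
    { toFun := fun q => ε • q
      map_add' := fun x y => smul_add _ _ _
      map_smul' := fun a x => by
        ext j
        rcases Int.units_eq_one_or (ε j) with h | h <;> simp [Units.smul_def, h] }
  have h : f q ∈ f '' convexHull ℝ (⋃ z' ∈ Metric.ball (ε • z) δ, depthRegion μ τ z') :=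
    Set.mem_image_of_mem f hq
  rw [f.image_convexHull] at h
  refine convexHull_mono ?_ h
  rintro _ ⟨q', hq', rfl⟩
  obtain ⟨z', hz', hq'⟩ := Set.mem_iUnion₂.1 hq'
  refine Set.mem_iUnion₂.2 ⟨ε • z', ?_, units_smul_mem_depthRegion ε hq'⟩
  rwa [Metric.mem_ball, ← dist_units_smul ε, units_smul_units_smul]

theorem exists_equivariant_selection [BorelSpace E] (μ : Measure E) [IsFiniteMeasure μ]
    {τ : ℝ≥0∞} (hτ : (m + 1) * τ < μ Set.univ) {δ : ℝ} (hδ : 0 < δ) :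
    ∃ φ : (Fin m → E) → Fin m → ℝ, Continuous φ ∧ (∀ z, φ z ∈ nearDepthRegion μ τ δ z) ∧
      ∀ (ε : Fin m → ℤˣ) z, φ (ε • z) = ε • φ z := by
  obtain ⟨g, hg⟩ := exists_continuous_forall_mem_convex_of_local_const
    (t := nearDepthRegion (m := m) μ τ δ) (fun z => convex_convexHull ℝ _) fun z => by
      obtain ⟨q, hq⟩ := depthRegion_nonempty μ hτ z
      refine ⟨q, Filter.mem_of_superset (Metric.ball_mem_nhds z hδ) fun z' hz' => ?_⟩
      exact subset_convexHull ℝ _ (Set.mem_iUnion₂.2 ⟨z, Metric.mem_ball_comm.1 hz', hq⟩)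
  have hcont : ∀ ε : Fin m → ℤˣ, Continuous fun z : Fin m → E => ε • z := fun ε =>
    (LipschitzWith.of_dist_le_mul (K := 1) fun z z' => by simp [dist_units_smul]).continuous
  have hcont' : ∀ ε : Fin m → ℤˣ, Continuous fun z : Fin m → ℝ => ε • z := fun ε =>
    (LipschitzWith.of_dist_le_mul (K := 1) fun z z' => by simp [dist_units_smul]).continuous
  refine ⟨fun z => ∑ ε : Fin m → ℤˣ, (Fintype.card (Fin m → ℤˣ) : ℝ)⁻¹ • ε • g (ε • z), ?_,
    fun z => ?_, fun η z => ?_⟩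
  · exact continuous_finsetSum _ fun ε _ =>
      ((hcont' ε).comp (g.continuous.comp (hcont ε))).fun_const_smul _
  · refine (convex_convexHull ℝ _).sum_mem (fun _ _ => by positivity) ?_ fun ε _ =>
      units_smul_mem_nearDepthRegion ε (hg _)
    simp
  · rw [Finset.smul_sum]
    refine Fintype.sum_equiv (Equiv.mulRight η) _ _ fun ε => ?_
    rw [Equiv.coe_mulRight, mul_smul ε η z, mul_smul ε η]
    ext j
    rcases Int.units_eq_one_or (η j) with h | h <;> simp [Units.smul_def, h]

end Selection

section Frame

open BorsukUlam

variable {d m lam : ℕ}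

/-- The `j`-th vector lies in the first `d - j` coordinates: on the boundary of the cube it is the
boundary point itself, and the product makes its last coordinate nonzero at the origin. -/
noncomputable def frame (y : (Σ j : Fin m, Fin (d - 1 - j)) → ℝ) (j : Fin m) :
    EuclideanSpace ℝ (Fin d) :=
  WithLp.toLp 2 fun c => if h : (c : ℕ) < d - 1 - j then y ⟨j, c, h⟩ else
    if (c : ℕ) = d - 1 - j then ∏ k, (1 - y ⟨j, k⟩ ^ 2) else 0

theorem continuous_frame : Continuous (frame (d := d) (m := m)) := by
  refine continuous_pi fun j => ?_
  refine (PiLp.continuous_toLp 2 _).comp (continuous_pi fun c => ?_)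
  split_ifs <;> fun_prop

theorem frame_ne_zero (hmd : m ≤ d) (y : (Σ j : Fin m, Fin (d - 1 - j)) → ℝ) (j : Fin m) :
    frame y j ≠ 0 := by
  intro h
  have h : ∀ c : Fin d, frame y j c = 0 := fun c => by rw [h]; rfl
  have h0 : ∀ k, y ⟨j, k⟩ = 0 := fun k => by
    have := h ⟨k, by lia⟩
    simpa [frame] using this
  have := h ⟨d - 1 - j, by lia⟩
  simp [frame, h0] at this

theorem frame_negBlock (y : (Σ j : Fin m, Fin (d - 1 - j)) → ℝ) (k : Σ j : Fin m, Fin (d - 1 - j))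
    (hk : |y k| = 1) : frame (negBlock Sigma.fst k.1 y) =
      (Function.update 1 k.1 (-1) : Fin m → ℤˣ) • frame y := by
  ext j c
  by_cases hj : j = k.1
  · subst hj
    have hprod : ∏ i, (1 - y ⟨k.1, i⟩ ^ 2) = 0 :=
      Finset.prod_eq_zero (Finset.mem_univ k.2) (by
        have : y ⟨k.1, k.2⟩ ^ 2 = 1 := by rw [← sq_abs, hk, one_pow]
        rw [this, sub_self])
    simp only [frame, negBlock, Pi.smul_apply', Function.update_self, Units.smul_def,
      if_true, neg_sq, hprod]
    split_ifs <;> simp [*]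
  · simp [frame, negBlock, hj]

theorem exists_frame (hd : lam + m = d)
    (φ : Fin (lam + 1) → (Fin m → EuclideanSpace ℝ (Fin d)) → Fin m → ℝ)
    (hφ : ∀ i, Continuous (φ i))
    (hφ' : ∀ i (ε : Fin m → ℤˣ) z, φ i (ε • z) = ε • φ i z) :
    ∃ y : (Σ j : Fin m, Fin (d - 1 - j)) → ℝ, (∀ k, |y k| ≤ 1) ∧
      (∀ i, φ i (frame y) = φ 0 (frame y)) ∧
      Pairwise fun j j' => ⟪frame y j, frame y j'⟫ = 0 := by
  obtain ⟨y, hy, hF⟩ := exists_common_zero (I := Σ j : Fin m, Fin (d - 1 - j)) Sigma.fst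
    (fun k b => if k.1 = b ∨ lam ≤ k.2 ∧ (b : ℕ) = k.1 + 1 + (k.2 - lam) then 1 else 0)
    (fun k b h => by
      rw [ite_ne_right_iff] at h
      rw [Fin.le_def]
      lia)
    (fun k => by simp)
    (fun k y => if h : (k.2 : ℕ) < lam then
        φ ⟨k.2 + 1, by lia⟩ (frame y) k.1 - φ 0 (frame y) k.1
      else ⟪frame y k.1, frame y ⟨k.1 + 1 + (k.2 - lam), by lia⟩⟫)
    (fun k => by
      have h : ∀ j, Continuous fun y => frame (d := d) (m := m) y j := fun j =>
        (continuous_apply j).comp continuous_frame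
      split_ifs
      · exact ((continuous_apply k.1).comp ((hφ _).comp continuous_frame)).sub
          ((continuous_apply k.1).comp ((hφ _).comp continuous_frame))
      · exact (h _).inner (h _))
    (fun k y c hc => by
      rw [frame_negBlock y c hc]
      simp only [hφ', Pi.smul_apply', Function.update_apply]
      by_cases h : (k.2 : ℕ) < lam
      · by_cases hkc : k.1 = c.1
        · simp [h, hkc, Units.smul_def]
          ring
        · simp [h, hkc, h.not_ge]
      · by_cases hkc : k.1 = c.1
        · have h2 : ∀ h', (⟨c.1 + 1 + (k.2 - lam), h'⟩ : Fin m) ≠ c.1 := fun h' => by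
            rw [Ne, Fin.ext_iff]
            simp only
            lia
          simp [h, hkc, h2, Units.smul_def]
        · by_cases h2 : (⟨k.1 + 1 + (k.2 - lam), by lia⟩ : Fin m) = c.1
          · have h3 := Fin.ext_iff.1 h2
            simp only at h3
            simp [h, hkc, h2, ← h3, not_lt.1 h, Units.smul_def]
          · have h3 : (c.1 : ℕ) ≠ k.1 + 1 + (k.2 - lam) := fun h3 => h2 (Fin.ext h3.symm)
            simp [h, hkc, h2, h3])
  refine ⟨y, hy, fun i => ?_, ?_⟩
  · ext j
    refine Fin.cases rfl (fun c => ?_) i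
    have := hF ⟨j, c, by lia⟩
    simp only [c.2, dif_pos] at this
    exact sub_eq_zero.1 this
  · refine pairwise_iff_lt.2 fun j j' hj => ?_
    have := hF ⟨j, lam + (j' - j - 1), by lia⟩
    rw [dif_neg (by simp)] at this
    convert this
    rw [Fin.lt_def] at hj
    simp only
    lia

end Frame

section Limit

open Filter Topology BorsukUlam

section

variable {E : Type*} [NormedAddCommGroup E] [InnerProductSpace ℝ E] [MeasurableSpace E] {m : ℕ}

theorem nearDepthRegion_subset_closedBall {μ : Measure E} {τ : ℝ≥0∞} {δ r C : ℝ} {z : Fin m → E}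
    (hr0 : 0 ≤ r) (hr : μ (Metric.closedBall 0 r)ᶜ < τ) (hz : ‖z‖ ≤ C) (hδ : δ ≤ 1) :
    nearDepthRegion μ τ δ z ⊆ Metric.closedBall 0 (r * (C + 1)) := by
  refine convexHull_min (Set.iUnion₂_subset fun z' hz' q hq => ?_) (convex_closedBall _ _)
  have hC : 0 ≤ C := (norm_nonneg z).trans hz
  rw [mem_closedBall_zero_iff]
  refine (pi_norm_le_iff_of_nonneg (by positivity)).2 fun j =>
    (norm_le_of_mem_depthRegion hr hq j).trans ?_
  have h1 : ‖z'‖ ≤ ‖z‖ + dist z' z := by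
    rw [dist_eq_norm]
    simpa using norm_add_le z (z' - z)
  have h2 := Metric.mem_ball.1 hz'
  have h3 := norm_le_pi_norm z' j
  gcongr
  linarith

theorem exists_le_halfSpaceMass {μ : Measure E} {τ : ℝ≥0∞} {δ : ℝ} {z : Fin m → E}
    {q : Fin m → ℝ} (hq : q ∈ nearDepthRegion μ τ δ z) (w : Fin m → ℝ) :
    ∃ z' ∈ Metric.ball z δ, τ ≤ halfSpaceMass μ z' q w := by
  obtain ⟨q', hq', hle⟩ : ∃ q' ∈ ⋃ z' ∈ Metric.ball z δ, depthRegion μ τ z',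
      ∑ j, w j * q j ≤ ∑ j, w j * q' j := by
    by_contra! h
    have := convexHull_min h (convex_halfSpace_lt (f := fun y : Fin m → ℝ => ∑ j, w j * y j)
      ⟨fun y y' => by simp [mul_add, Finset.sum_add_distrib],
        fun a y => by simp [Finset.mul_sum, mul_left_comm]⟩ (∑ j, w j * q j)) hq
    exact lt_irrefl (∑ j, w j * q j) this
  obtain ⟨z', hz', hq'⟩ := Set.mem_iUnion₂.1 hq'
  exact ⟨z', hz', (hq' w).trans (measure_mono fun p hp => hle.trans hp)⟩

theorem le_halfSpaceMass_of_tendsto [BorelSpace E] (μ : Measure E) [IsFiniteMeasure μ]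
    {τ : ℕ → ℝ≥0∞} {T : ℝ≥0∞} {δ : ℕ → ℝ} {z : ℕ → Fin m → E} {z₀ : Fin m → E}
    {q : ℕ → Fin m → ℝ} {q₀ : Fin m → ℝ} (hτ : Tendsto τ atTop (𝓝 T))
    (hδ : Tendsto δ atTop (𝓝 0)) (hz : Tendsto z atTop (𝓝 z₀)) (hq : Tendsto q atTop (𝓝 q₀))
    (hmem : ∀ k, q k ∈ nearDepthRegion μ (τ k) (δ k) (z k)) (w : Fin m → ℝ) :
    T ≤ halfSpaceMass μ z₀ q₀ w := by
  choose z' hz' hmass using fun k => exists_le_halfSpaceMass (hmem k) w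
  have hz'lim : Tendsto z' atTop (𝓝 z₀) := by
    refine (tendsto_iff_of_dist ?_).2 hz
    exact squeeze_zero (fun _ => dist_nonneg) (fun k => (Metric.mem_ball.1 (hz' k)).le) hδ
  let S : ℕ → Set E := fun k => {p | ∑ j, w j * q k j ≤ ∑ j, w j * ⟪p, z' k j⟫}
  have hlim := tendsto_measure_iInter_atTop (μ := μ) (s := fun N => ⋃ k ≥ N, S k)
    (fun N => (MeasurableSet.biUnion (Set.to_countable _) fun k _ =>
      (isClosed_halfSpace _ _ _).measurableSet).nullMeasurableSet)
    (fun N N' h => Set.biUnion_mono (fun k hk => h.trans hk) fun _ _ => subset_rfl)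
    ⟨0, measure_ne_top _ _⟩
  refine (le_of_tendsto_of_tendsto' hτ hlim fun N => (hmass N).trans
    (measure_mono (Set.subset_biUnion_of_mem (u := S) (le_refl N)))).trans
    (measure_mono fun p hp => ?_)
  by_contra h
  rw [Set.mem_ofPred_eq, not_le] at h
  have h1 : Tendsto (fun k => ∑ j, w j * q k j) atTop (𝓝 (∑ j, w j * q₀ j)) :=
    tendsto_finsetSum _ fun j _ => (tendsto_pi_nhds.1 hq j).const_mul _
  have h2 : Tendsto (fun k => ∑ j, w j * ⟪p, z' k j⟫) atTop (𝓝 (∑ j, w j * ⟪p, z₀ j⟫)) :=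
    tendsto_finsetSum _ fun j _ =>
      (tendsto_const_nhds.inner (tendsto_pi_nhds.1 hz'lim j)).const_mul _
  obtain ⟨N, hN⟩ := eventually_atTop.1 (h2.eventually_lt h1 h)
  obtain ⟨k, hk, hpk⟩ := Set.mem_iUnion₂.1 (Set.mem_iInter.1 hp N)
  exact (hN k hk).not_ge hpk

end

theorem exists_deep_frame {d m lam : ℕ} (hd : lam + m = d)
    (μ : Fin (lam + 1) → Measure (EuclideanSpace ℝ (Fin d))) [∀ i, IsFiniteMeasure (μ i)]
    (hμ : ∀ i, μ i ≠ 0) :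
    ∃ (x : Fin m → EuclideanSpace ℝ (Fin d)) (q : Fin m → ℝ), (∀ j, x j ≠ 0) ∧
      (Pairwise fun j j' => ⟪x j, x j'⟫ = 0) ∧
      ∀ i w, μ i Set.univ / (m + 1) ≤ halfSpaceMass (μ i) x q w := by
  have hpos : ∀ i, 0 < μ i Set.univ / (m + 1) := fun i =>
    ENNReal.div_pos (by simpa using hμ i) (by simp)
  obtain ⟨τ₀, hτ₀, hτ₀'⟩ := exists_between (hpos 0)
  obtain ⟨r, hr⟩ := exists_measure_compl_closedBall_lt (μ 0) hτ₀
  have hlow : ∀ i, (if i = 0 then τ₀ else 0) < μ i Set.univ / (m + 1) := fun i => by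
    split_ifs with h
    · rwa [h]
    · exact hpos i
  choose τ _ hτmem hτlim using fun i => exists_seq_strictMono_tendsto' (hlow i)
  have happrox : ∀ k : ℕ, ∃ y : (Σ j : Fin m, Fin (d - 1 - j)) → ℝ, (∀ c, |y c| ≤ 1) ∧
      (Pairwise fun j j' => ⟪frame y j, frame y j'⟫ = 0) ∧
      ∃ q, ∀ i, q ∈ nearDepthRegion (μ i) (τ i k) (1 / (k + 1)) (frame y) := by
    intro k
    choose φ hφ hφmem hφ' using fun i => exists_equivariant_selection (m := m) (μ i) (τ := τ i k)
      (by
        rw [mul_comm]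
        exact (ENNReal.lt_div_iff_mul_lt (by simp) (by simp)).1 (hτmem i k).2)
      (Nat.one_div_pos_of_nat (α := ℝ) (n := k))
    obtain ⟨y, hy, hyφ, hyorth⟩ := exists_frame hd φ hφ hφ'
    exact ⟨y, hy, hyorth, φ 0 (frame y), fun i => hyφ i ▸ hφmem i _⟩
  choose y hy horth q hq using happrox
  have hcube : ∀ k, y k ∈ Set.Icc (-1) 1 := fun k =>
    ⟨fun c => (abs_le.1 (hy k c)).1, fun c => (abs_le.1 (hy k c)).2⟩
  obtain ⟨C, hC⟩ := isCompact_Icc.exists_bound_of_continuousOn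
    (continuous_frame (d := d) (m := m)).continuousOn
  have hball : ∀ k, q k ∈ Metric.closedBall 0 (r * (C + 1)) := fun k =>
    nearDepthRegion_subset_closedBall r.cast_nonneg
      (hr.trans (by simpa using (hτmem 0 k).1)) (hC _ (hcube k))
      (by simpa using Nat.one_div_le_one_div (α := ℝ) k.zero_le) (hq k 0)
  obtain ⟨⟨y₀, q₀⟩, -, ψ, hψ, hlim⟩ :=
    (isCompact_Icc.prod (isCompact_closedBall _ _)).tendsto_subseq (x := fun k => (y k, q k))
      fun k => ⟨hcube k, hball k⟩
  have hylim : Tendsto (fun k => frame (y (ψ k))) atTop (𝓝 (frame y₀)) :=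
    (continuous_frame.tendsto y₀).comp (continuous_fst.tendsto (y₀, q₀) |>.comp hlim)
  have hqlim : Tendsto (fun k => q (ψ k)) atTop (𝓝 q₀) :=
    (continuous_snd.tendsto (y₀, q₀)).comp hlim
  refine ⟨frame y₀, q₀, frame_ne_zero (by lia) y₀, fun j j' hj => ?_, fun i w => ?_⟩
  · refine tendsto_nhds_unique ((tendsto_pi_nhds.1 hylim j).inner (tendsto_pi_nhds.1 hylim j')) ?_
    simp only [horth _ hj, tendsto_const_nhds]
  · exact le_halfSpaceMass_of_tendsto (μ i) ((hτlim i).comp hψ.tendsto_atTop)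
      ((tendsto_one_div_add_atTop_nhds_zero_nat (𝕜 := ℝ)).comp hψ.tendsto_atTop) hylim hqlim
      (fun k => hq (ψ k) i) w

/-- A frame together with a value determines an affine subspace, all of whose supporting
half-spaces are given by the combinations of the frame. -/
theorem exists_affineSubspace_of_frame {E : Type*} [NormedAddCommGroup E] [InnerProductSpace ℝ E]
    [MeasurableSpace E] [FiniteDimensional ℝ E] {m : ℕ} {x : Fin m → E} (q : Fin m → ℝ)
    (hx : ∀ j, x j ≠ 0) (horth : Pairwise fun j j' => ⟪x j, x j'⟫ = 0) :
    ∃ L : AffineSubspace ℝ E, (L : Set E).Nonempty ∧ finrank ℝ L.direction + m = finrank ℝ E ∧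
      ∀ v c, (∀ y ∈ L, c ≤ ⟪y, v⟫) → ∃ w : Fin m → ℝ,
        {p | ∑ j, w j * q j ≤ ∑ j, w j * ⟪p, x j⟫} ⊆ {p | c ≤ ⟪p, v⟫} := by
  have hli : LinearIndependent ℝ x := linearIndependent_of_ne_zero_of_inner_eq_zero hx horth
  set V := Submodule.span ℝ (Set.range x) with hV
  set p₀ := ∑ j, (q j / ⟪x j, x j⟫) • x j with hp₀
  have hp₀x : ∀ j, ⟪p₀, x j⟫ = q j := fun j => by
    rw [hp₀, sum_inner, Finset.sum_eq_single j]
    · rw [real_inner_smul_left, div_mul_cancel₀ _ (inner_self_ne_zero.2 (hx j))]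
    · intro k _ hk
      rw [real_inner_smul_left, horth hk, mul_zero]
    · simp
  refine ⟨AffineSubspace.mk' p₀ Vᗮ, ⟨p₀, AffineSubspace.self_mem_mk' _ _⟩, ?_, fun v c hL => ?_⟩
  · rw [AffineSubspace.direction_mk', ← V.finrank_add_finrank_orthogonal, add_comm, hV,
      finrank_span_eq_card hli, Fintype.card_fin]
  · have hL' : ∀ u ∈ Vᗮ, c ≤ ⟪u, v⟫ + ⟪p₀, v⟫ := fun u hu => by
      rw [← inner_add_left]
      exact hL _ (AffineSubspace.vadd_mem_mk' p₀ hu)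
    have hv : v ∈ V := by
      rw [← V.orthogonal_orthogonal, Submodule.mem_orthogonal]
      intro u hu
      by_contra hne
      have := hL' (((c - ⟪p₀, v⟫ - 1) / ⟪u, v⟫) • u) (Vᗮ.smul_mem _ hu)
      rw [real_inner_smul_left, div_mul_cancel₀ _ hne] at this
      linarith
    obtain ⟨w, rfl⟩ := (Submodule.mem_span_range_iff_exists_fun ℝ).1 hv
    have h0 := hL' 0 (Submodule.zero_mem _)
    simp only [inner_sum, real_inner_smul_right, hp₀x, inner_zero_left,
      Finset.sum_const_zero, zero_add] at h0 ⊢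
    exact ⟨w, fun p hp => h0.trans hp⟩

end Limit
end CentralTransversal

/-- **Central transversal theorem** (Dol'nikov; Živaljević–Vrećica).  Given `lam + 1` finite
measures on `ℝ^d` with `0 ≤ lam < d`, there is a `lam`-dimensional affine subspace `L` such
that every closed half-space `{x : ⟪x, v⟫ ≥ c}` containing `L` has measure at least
`μᵢ(ℝ^d)/(d+1-lam)` for each `i`. -/
theorem central_transversal (d lam : ℕ) (hlam : lam < d)
    (μ : Fin (lam + 1) → Measure (EuclideanSpace ℝ (Fin d)))
    [∀ i, IsFiniteMeasure (μ i)] :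
    ∃ L : AffineSubspace ℝ (EuclideanSpace ℝ (Fin d)),
      (L : Set (EuclideanSpace ℝ (Fin d))).Nonempty ∧
      Module.finrank ℝ L.direction = lam ∧
      ∀ i, ∀ v : EuclideanSpace ℝ (Fin d), v ≠ 0 → ∀ c : ℝ,
        (∀ y ∈ L, ⟪y, v⟫ ≥ c) →
        μ i {x | ⟪x, v⟫ ≥ c} ≥ μ i Set.univ / ((d + 1 - lam : ℕ) : ℝ≥0∞) := by
  classical
  obtain ⟨m, rfl⟩ := Nat.exists_eq_add_of_lt hlam
  let ν : Fin (lam + 1) → Measure (EuclideanSpace ℝ (Fin (lam + m + 1))) := fun i =>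
    if μ i = 0 then Measure.dirac 0 else μ i
  have hν : ∀ i, IsFiniteMeasure (ν i) := fun i => by
    simp only [ν]
    split_ifs <;> infer_instance
  have hν0 : ∀ i, ν i ≠ 0 := fun i => by
    simp only [ν]
    split_ifs with h
    · exact Measure.dirac_ne_zero
    · exact h
  obtain ⟨x, q, hx, horth, hmass⟩ :=
    CentralTransversal.exists_deep_frame (m := m + 1) (by ring) ν hν0
  obtain ⟨L, hL, hdim, hLw⟩ := CentralTransversal.exists_affineSubspace_of_frame q hx horth
  refine ⟨L, hL, ?_, fun i v _ c hc => ?_⟩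
  · rw [finrank_euclideanSpace_fin] at hdim
    exact Nat.add_right_cancel (hdim.trans (add_assoc lam m 1))
  · rcases eq_or_ne (μ i) 0 with h | h
    · simp [h]
    · obtain ⟨w, hw⟩ := hLw v c hc
      have h1 := hmass i w
      rw [show ν i = μ i from if_neg h] at h1
      have h2 : lam + m + 1 + 1 - lam = m + 1 + 1 := by lia
      rw [h2]
      exact (by exact_mod_cast h1 : μ i Set.univ / ((m + 1 + 1 : ℕ) : ℝ≥0∞) ≤ _).trans
        (measure_mono hw)
end

section
/- Let d ≥ 2. For i = 1, …, d let μᵢ be a finite measure on ℝ^d × S^{d-1} (a pair (p, u) encodes the line p + ℝu in ℝ^d), each absolutely continuous with respect to the product of the Lebesgue measure on ℝ^d and the uniform (spherical) measure on S^{d-1}. For a unit vector v orthogonal to e_d and a pair (p, u) with ⟨u, v⟩ ≠ 0, define the vertical speed z(v, (p,u)) = ⟨u, e_d⟩ / ⟨u, v⟩. For a vertical hyperplane H = {x : ⟨x, v⟩ = c}, define the induced measure μᵢ^H on ℝ by μᵢ^H(B) = μᵢ{(p, u) : ⟨u, v⟩ ≠ 0 and the e_d-coordinate of the unique intersection point of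 the line p + ℝu with H lies in B}. Then at least one of the following holds: (a) there exist a unit vector v ⊥ e_d and a real number m such that for every i, μᵢ{(p,u) : ⟨u,v⟩ ≠ 0, z(v,(p,u)) ≤ m} = μᵢ{(p,u) : ⟨u,v⟩ ≠ 0, z(v,(p,u)) ≥ m} (all measures share a median vertical speed in direction v); or (b) there exist a unit vector v ⊥ e_d, c ∈ ℝ, and h ∈ ℝ such that for the vertical hyperplane S_{d-1} = {x : ⟨x, v⟩ = c} and every i = 1, …, d, μᵢ^{S_{d-1}}([h, ∞)) = μᵢ^{S_{d-1}}((−∞, h]); that is, the horizontal affine (d−2)-dimensional subspace {x ∈ S_{d-1} : ⟨x, e_d⟩ = h} bisects each induced measure. -/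
open MeasureTheory
open scoped RealInnerProductSpace ENNReal

namespace UnionJack

/-- A flag of the Union Jack triangulation of `ℝ^N`: half of the base vertex (which has even
coordinates), the order in which the coordinates are changed, and the direction of each change. -/
abbrev Flag (N : ℕ) := (Fin N → ℤ) × Equiv.Perm (Fin N) × (Fin N → ℤˣ)

variable {N : ℕ}

/-- The `j`-th vertex of the simplex described by a flag. -/
def vertex (σ : Flag N) (j : ℕ) : Fin N → ℤ :=
  fun c => 2 * σ.1 c + if (σ.2.1 c : ℕ) < j then (σ.2.2 c : ℤ) else 0

/-- The flags of the simplices that triangulate the cube `[-(2M+1), 2M+1]^N`. -/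
noncomputable def flags (N M : ℕ) : Finset (Flag N) :=
  (Fintype.piFinset fun _ => Finset.Icc (-(M : ℤ)) M) ×ˢ Finset.univ

/-- The image of a simplex under `x ↦ -x`. -/
def antipode (σ : Flag N) : Flag N := (-σ.1, σ.2.1, -σ.2.2)

/-- The lattice points on the boundary of the cube `[-(2M+1), 2M+1]^N`. -/
def IsBoundary (M : ℕ) (x : Fin N → ℤ) : Prop :=
  (∀ c, |x c| ≤ 2 * M + 1) ∧ ∃ c, |x c| = 2 * M + 1

lemma mem_flags {M : ℕ} {σ : Flag N} : σ ∈ flags N M ↔ ∀ c, |σ.1 c| ≤ M := by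
  simp [flags, abs_le]

lemma vertex_antipode (σ : Flag N) (j : ℕ) : vertex (antipode σ) j = -vertex σ j := by
  funext c
  by_cases h : (σ.2.1 c : ℕ) < j <;> simp [vertex, antipode, h, add_comm]

lemma antipode_antipode (σ : Flag N) : antipode (antipode σ) = σ := by
  simp [antipode]

lemma antipode_mem {M : ℕ} {σ : Flag N} (h : σ ∈ flags N M) : antipode σ ∈ flags N M := by
  rw [mem_flags] at h ⊢
  simpa [antipode] using h

lemma antipode_ne (hN : 0 < N) (σ : Flag N) : antipode σ ≠ σ := by
  intro h
  have h1 : -(σ.2.2 ⟨0, hN⟩) = σ.2.2 ⟨0, hN⟩ := congrFun (congrArg (fun τ => τ.2.2) h) ⟨0, hN⟩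
  exact neg_units_ne_self _ h1

lemma abs_vertex_le {M : ℕ} {σ : Flag N} (h : σ ∈ flags N M) (j : ℕ) (c : Fin N) :
    |vertex σ j c| ≤ 2 * M + 1 := by
  have h1 := abs_le.1 (mem_flags.1 h c)
  rw [abs_le]
  simp only [vertex]
  rcases Int.units_eq_one_or (σ.2.2 c) with h2 | h2 <;> split_ifs <;> simp [h2] <;> omega

lemma abs_vertex_sub_le (σ : Flag N) (i j : ℕ) (c : Fin N) :
    |vertex σ i c - vertex σ j c| ≤ 1 := by
  rw [abs_le]
  simp only [vertex]
  rcases Int.units_eq_one_or (σ.2.2 c) with h2 | h2 <;> split_ifs <;> simp [h2]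

/-- A mod 2 sum over all flags vanishes if the summand ignores the `k`-th vertex, `1 ≤ k`. -/
lemma sum_eq_zero_of_ignores {M k : ℕ} (hk : 1 ≤ k) (hkN : k ≤ N) {f : Flag N → ZMod 2}
    (hf : ∀ σ τ, (∀ j ≤ N, j ≠ k → vertex σ j = vertex τ j) → f σ = f τ) :
    ∑ σ ∈ flags N M, f σ = 0 := by
  rcases hkN.eq_or_lt with rfl | hlt
  · let c (σ : Flag k) : Fin k := σ.2.1.symm ⟨k - 1, by omega⟩
    let g (σ : Flag k) : Flag k := (σ.1, σ.2.1, Function.update σ.2.2 (c σ) (-σ.2.2 (c σ)))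
    refine Finset.sum_involution (fun σ _ => g σ) ?_ ?_ ?_ ?_
    · intro σ _
      rw [hf (g σ) σ, CharTwo.add_self_eq_zero]
      intro j hj hjk
      funext a
      simp only [vertex, g]
      by_cases ha : a = c σ
      · have : ¬ ((σ.2.1 a : ℕ) < j) := by
          simp [ha, c]; omega
        simp [this]
      · simp [Function.update_of_ne ha]
    · intro σ _ _ h
      have h1 := congrFun (congrArg (fun τ => τ.2.2) h) (c σ)
      simp only [g, Function.update_self] at h1
      exact neg_units_ne_self _ h1
    · intro σ hσ
      rw [mem_flags] at hσ ⊢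
      exact hσ
    · intro σ _
      simp [g, c]
  · let a : Fin N := ⟨k - 1, by omega⟩
    let b : Fin N := ⟨k, hlt⟩
    have hab : a ≠ b := by simp [a, b, Fin.ext_iff]; omega
    let g (σ : Flag N) : Flag N := (σ.1, σ.2.1.trans (Equiv.swap a b), σ.2.2)
    refine Finset.sum_involution (fun σ _ => g σ) ?_ ?_ ?_ ?_
    · intro σ _
      rw [hf (g σ) σ, CharTwo.add_self_eq_zero]
      intro j hj hjk
      funext c
      simp only [vertex, g, Equiv.trans_apply]
      have : ((Equiv.swap a b (σ.2.1 c) : Fin N) : ℕ) < j ↔ (σ.2.1 c : ℕ) < j := by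
        rw [Equiv.swap_apply_def]
        split_ifs with h1 h2
        · simp [h1, a, b]; omega
        · simp [h2, a, b]; omega
        · rfl
      simp [this]
    · intro σ _ _ h
      have h1 : Equiv.swap a b (σ.2.1 (σ.2.1.symm a)) = σ.2.1 (σ.2.1.symm a) :=
        congrArg (fun τ : Flag N => τ.2.1 (σ.2.1.symm a)) h
      rw [Equiv.apply_symm_apply, Equiv.swap_apply_left] at h1
      exact hab h1.symm
    · intro σ hσ
      rw [mem_flags] at hσ ⊢
      exact hσ
    · intro σ _
      refine Prod.ext rfl (Prod.ext ?_ rfl)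
      ext c
      simp [g]

/-- A mod 2 sum over all flags vanishes if the summand ignores the base vertex and takes equal
values at antipodal facets of the boundary. -/
lemma sum_eq_zero_of_ignores_base {M : ℕ} (hN : 0 < N) {f : Flag N → ZMod 2}
    (hf : ∀ σ τ, (∀ j ≤ N, j ≠ 0 → vertex σ j = vertex τ j) → f σ = f τ)
    (hb : ∀ σ, (∀ j ≤ N, j ≠ 0 → IsBoundary M (vertex σ j)) → f (antipode σ) = f σ) :
    ∑ σ ∈ flags N M, f σ = 0 := by
  let c (σ : Flag N) : Fin N := σ.2.1.symm ⟨0, hN⟩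
  let g (σ : Flag N) : Flag N :=
    (Function.update σ.1 (c σ) (σ.1 (c σ) + σ.2.2 (c σ)), σ.2.1,
      Function.update σ.2.2 (c σ) (-σ.2.2 (c σ)))
  have hgg (σ : Flag N) : g (g σ) = σ := by simp [g, c]
  let P (σ : Flag N) : Prop := |σ.1 (c σ) + σ.2.2 (c σ)| ≤ M
  have hPa (σ : Flag N) : P (antipode σ) ↔ P σ := by
    have : (antipode σ).1 (c (antipode σ)) + (antipode σ).2.2 (c (antipode σ)) =
        -(σ.1 (c σ) + σ.2.2 (c σ)) := by
      simp [c, antipode, add_comm]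
    simp only [P, this, abs_neg]
  have hPg (σ : Flag N) (h : σ ∈ flags N M) : P (g σ) := by
    have := mem_flags.1 h (c σ)
    simpa [P, g, c] using this
  classical
  refine Finset.sum_involution (fun σ _ => if P σ then g σ else antipode σ) ?_ ?_ ?_ ?_
  · intro σ hσ
    split_ifs with h
    · rw [hf (g σ) σ, CharTwo.add_self_eq_zero]
      intro j hj hj0
      funext a
      simp only [vertex, g]
      by_cases ha : a = c σ
      · have : (σ.2.1 a : ℕ) < j := by simp [ha, c]; omega
        simp only [if_pos this]
        subst ha
        simp only [Function.update_self, Units.val_neg]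
        ring
      · simp [Function.update_of_ne ha]
    · rw [hb σ, CharTwo.add_self_eq_zero]
      intro j hj hj0
      refine ⟨abs_vertex_le hσ j, c σ, ?_⟩
      have hlt : (σ.2.1 (c σ) : ℕ) < j := by simp [c]; omega
      simp only [vertex, if_pos hlt]
      have h1 := mem_flags.1 hσ (c σ)
      simp only [P] at h
      rcases Int.units_eq_one_or (σ.2.2 (c σ)) with h2 | h2 <;>
        simp only [h2, Units.val_one, Units.val_neg] at h ⊢ <;>
        simp only [abs_eq_max_neg] at * <;> omega
  · intro σ _ _
    split_ifs
    · intro h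
      have h1 := congrFun (congrArg (fun τ => τ.2.2) h) (c σ)
      simp only [g, Function.update_self] at h1
      exact neg_units_ne_self _ h1
    · exact antipode_ne hN σ
  · intro σ hσ
    split_ifs with h
    · rw [mem_flags] at hσ ⊢
      intro a
      by_cases ha : a = c σ
      · subst ha
        simpa [g] using h
      · simpa [g, Function.update_of_ne ha] using hσ a
    · exact antipode_mem hσ
  · intro σ hσ
    by_cases h : P σ
    · simp only [if_pos h, if_pos (hPg σ hσ), hgg]
    · have h' : ¬ P (antipode σ) := by rwa [hPa]
      simp only [if_neg h, if_neg h', antipode_antipode]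

/-- The number modulo 2 of simplices along whose `i`-th edge the `i`-th labelling changes. -/
noncomputable def changeCount (M : ℕ) (s : Fin N → (Fin N → ℤ) → ZMod 2) : ZMod 2 :=
  ∑ σ ∈ flags N M, ∏ i : Fin N, (s i (vertex σ i) + s i (vertex σ (i + 1)))

lemma changeCount_eq_zero {M : ℕ} {s : Fin N → (Fin N → ℤ) → ZMod 2} (r : Fin N)
    (hr : ∀ x, IsBoundary M x → s r (-x) = s r x)
    (hs : ∀ i ≠ r, ∀ x, IsBoundary M x → s i (-x) = s i x + 1) :
    changeCount M s = 0 := by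
  have hN : 0 < N := r.pos
  let A (k : ℕ) (σ : Flag N) : ZMod 2 := ∏ i : Fin N,
    if i < r then
      (if (i : ℕ) < k then s i (vertex σ i) + s i (vertex σ (i + 1))
        else s i (vertex σ (i + 1)) + s i (vertex σ (i + 2)))
    else if i = r then s i (vertex σ (i + 1)) else s i (vertex σ i) + s i (vertex σ (i + 1))
  let B (k : ℕ) (σ : Flag N) : ZMod 2 := ∏ i : Fin N,
    if i < r then s i (vertex σ i) + s i (vertex σ (i + 1))
    else if i = r then s i (vertex σ i)
    else if (i : ℕ) < k then s i (vertex σ (i - 1)) + s i (vertex σ i)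
      else s i (vertex σ i) + s i (vertex σ (i + 1))
  have hsplit : changeCount M s = ∑ σ ∈ flags N M, A r σ + ∑ σ ∈ flags N M, B (r + 1) σ := by
    rw [← Finset.sum_add_distrib]
    refine Finset.sum_congr rfl fun σ _ => (Finset.prod_add_prod_eq (Finset.mem_univ r) ?_ ?_ ?_).symm
    · simp [add_comm]
    · intro j _ hj
      by_cases h : j < r
      · simp [h]
      · simp [h, hj]
    · intro j _ hj
      by_cases h : j < r
      · simp [h]
      · have : ¬ ((j : ℕ) < r + 1) := by
          have : (j : ℕ) ≠ r := fun h => hj (Fin.ext h)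
          rw [Fin.lt_def] at h; omega
        simp [h, hj, this]
  have hA : ∀ k : ℕ, k ≤ r → ∑ σ ∈ flags N M, A k σ = 0 := by
    intro k
    induction k with
    | zero =>
      intro _
      apply sum_eq_zero_of_ignores_base hN
      · intro σ τ h
        refine Finset.prod_congr rfl fun i _ => ?_
        have h1 := h (i + 1) (by omega) (by omega)
        split_ifs with h2 h3 h3
        · omega
        · rw [h1, h (i + 2) (by rw [Fin.lt_def] at h2; omega) (by omega)]
        · rw [h1]
        · rw [h1, h i (by omega) (by rw [Fin.lt_def] at h2; rw [Fin.ext_iff] at h3; omega)]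
      · intro σ h
        refine Finset.prod_congr rfl fun i _ => ?_
        simp only [vertex_antipode]
        have h1 := h (i + 1) (by omega) (by omega)
        have e (a b : ZMod 2) : (a + 1) + (b + 1) = a + b := by
          revert a b; decide
        split_ifs with h2 h3 h3
        · omega
        · rw [hs i h2.ne _ h1, hs i h2.ne _
            (h (i + 2) (by rw [Fin.lt_def] at h2; omega) (by omega)), e]
        · subst h3
          exact hr _ h1
        · rw [hs i h3 _ h1, hs i h3 _ (h i (by omega)
            (by rw [Fin.lt_def] at h2; rw [Fin.ext_iff] at h3; omega)), e]
    | succ k ih =>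
      intro hk
      have h0 := ih (by omega)
      suffices h : ∑ σ ∈ flags N M, (A k σ + A (k + 1) σ) = 0 by
        rwa [Finset.sum_add_distrib, h0, zero_add] at h
      let q : Fin N := ⟨k, by omega⟩
      have hq : q < r := by rw [Fin.lt_def]; simp only [q]; omega
      have hsum (σ : Flag N) : A k σ + A (k + 1) σ = ∏ i : Fin N,
          if i = q then s i (vertex σ i) + s i (vertex σ (i + 2)) else
          if i < r then
            (if (i : ℕ) < k then s i (vertex σ i) + s i (vertex σ (i + 1))
              else s i (vertex σ (i + 1)) + s i (vertex σ (i + 2)))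
          else if i = r then s i (vertex σ (i + 1))
            else s i (vertex σ i) + s i (vertex σ (i + 1)) := by
        refine Finset.prod_add_prod_eq (Finset.mem_univ q) ?_ ?_ ?_
        · rw [if_pos hq, if_pos hq, if_neg (by simp [q]), if_pos (by simp [q]), if_pos rfl]
          have e (a b c : ZMod 2) : (a + b) + (c + a) = c + b := by
            revert a b c; decide
          exact e _ _ _
        · intro j _ hj
          rw [if_neg hj]
        · intro j _ hj
          have : ((j : ℕ) < k + 1) ↔ (j : ℕ) < k := by
            have : (j : ℕ) ≠ k := fun h => hj (Fin.ext h)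
            omega
          simp only [if_neg hj, this]
      simp only [hsum]
      apply sum_eq_zero_of_ignores (k := k + 1) (by omega) (by omega)
      intro σ τ h
      refine Finset.prod_congr rfl fun i _ => ?_
      split_ifs with h2 h3 h4 h4
      · rw [h i (by omega) (by simp [h2, q]),
          h (i + 2) (by simp [h2, q]; omega) (by simp [h2, q])]
      · rw [h i (by omega) (by omega), h (i + 1) (by omega) (by omega)]
      · have h5 : (i : ℕ) ≠ k := fun h => h2 (Fin.ext h)
        rw [Fin.lt_def] at h3
        rw [h (i + 1) (by omega) (by omega), h (i + 2) (by omega) (by omega)]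
      · rw [h4, h (r + 1) (by omega) (by omega)]
      · rw [Fin.lt_def] at h3
        rw [Fin.ext_iff] at h4
        rw [h i (by omega) (by omega), h (i + 1) (by omega) (by omega)]
  have hB : ∀ m k : ℕ, k + m = N → r + 1 ≤ k → ∑ σ ∈ flags N M, B k σ = 0 := by
    intro m
    induction m with
    | zero =>
      intro k hk hrk
      apply sum_eq_zero_of_ignores (k := N) hN le_rfl
      intro σ τ h
      refine Finset.prod_congr rfl fun i _ => ?_
      split_ifs with h2 h3 h4
      · rw [Fin.lt_def] at h2
        rw [h i (by omega) (by omega), h (i + 1) (by omega) (by omega)]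
      · rw [h i (by omega) (by omega)]
      · rw [h i (by omega) (by omega), h (i - 1) (by omega) (by omega)]
      · omega
    | succ m ih =>
      intro k hk hrk
      have h0 := ih (k + 1) (by omega) (by omega)
      suffices h : ∑ σ ∈ flags N M, (B k σ + B (k + 1) σ) = 0 by
        rwa [Finset.sum_add_distrib, h0, add_zero] at h
      let q : Fin N := ⟨k, by omega⟩
      have hq : ¬ q < r := by rw [Fin.lt_def]; simp only [q]; omega
      have hq' : q ≠ r := by rw [Ne, Fin.ext_iff]; simp only [q]; omega
      have hsum (σ : Flag N) : B k σ + B (k + 1) σ = ∏ i : Fin N,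
          if i = q then s i (vertex σ (i - 1)) + s i (vertex σ (i + 1)) else
          if i < r then s i (vertex σ i) + s i (vertex σ (i + 1))
          else if i = r then s i (vertex σ i)
          else if (i : ℕ) < k then s i (vertex σ (i - 1)) + s i (vertex σ i)
            else s i (vertex σ i) + s i (vertex σ (i + 1)) := by
        refine Finset.prod_add_prod_eq (Finset.mem_univ q) ?_ ?_ ?_
        · rw [if_neg hq, if_neg hq, if_neg hq', if_neg hq', if_neg (by simp [q]),
            if_pos (by simp [q]), if_pos rfl]
          have e (a b c : ZMod 2) : (a + b) + (c + a) = c + b := by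
            revert a b c; decide
          exact e _ _ _
        · intro j _ hj
          rw [if_neg hj]
        · intro j _ hj
          have : ((j : ℕ) < k + 1) ↔ (j : ℕ) < k := by
            have : (j : ℕ) ≠ k := fun h => hj (Fin.ext h)
            omega
          simp only [if_neg hj, this]
      simp only [hsum]
      apply sum_eq_zero_of_ignores (k := k) (by omega) (by omega)
      intro σ τ h
      refine Finset.prod_congr rfl fun i _ => ?_
      split_ifs with h2 h3 h4 h4
      · rw [h (i - 1) (by omega) (by simp [h2, q]; omega),
          h (i + 1) (by omega) (by simp [h2, q])]
      · rw [Fin.lt_def] at h3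
        rw [h i (by omega) (by omega), h (i + 1) (by omega) (by omega)]
      · rw [h i (by omega) (by rw [h4]; omega)]
      · rw [h i (by omega) (by omega), h (i - 1) (by omega) (by omega)]
      · have h5 : (i : ℕ) ≠ k := fun h => h2 (Fin.ext h)
        rw [h i (by omega) (by omega), h (i + 1) (by omega) (by omega)]
  rw [hsplit, hA r le_rfl, hB (N - (r + 1)) (r + 1) (by omega) le_rfl, add_zero]

/-- The count of simplices with changing labels is the same for all labellings that are
antisymmetric on the boundary. -/
lemma changeCount_congr {M : ℕ} {s t : Fin N → (Fin N → ℤ) → ZMod 2}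
    (hs : ∀ i x, IsBoundary M x → s i (-x) = s i x + 1)
    (ht : ∀ i x, IsBoundary M x → t i (-x) = t i x + 1) :
    changeCount M s = changeCount M t := by
  let h (k : ℕ) (i : Fin N) : (Fin N → ℤ) → ZMod 2 := if (i : ℕ) < k then t i else s i
  have key : ∀ k ≤ N, changeCount M (h k) = changeCount M s := by
    intro k
    induction k with
    | zero =>
      intro _
      simp [h]
    | succ k ih =>
      intro hk
      rw [← ih (by omega)]
      let q : Fin N := ⟨k, by omega⟩
      let w (i : Fin N) (x : Fin N → ℤ) : ZMod 2 := if i = q then s i x + t i x else h k i x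
      have hw : changeCount M w = 0 := by
        apply changeCount_eq_zero q
        · intro x hx
          have e (a b : ZMod 2) : (a + 1) + (b + 1) = a + b := by
            revert a b; decide
          simp only [w, if_true, hs _ x hx, ht _ x hx, e]
        · intro i hi x hx
          simp only [w, if_neg hi, h]
          split_ifs
          · exact ht i x hx
          · exact hs i x hx
      have hadd : changeCount M (h (k + 1)) + changeCount M (h k) = changeCount M w := by
        rw [changeCount, changeCount, ← Finset.sum_add_distrib]
        refine Finset.sum_congr rfl fun σ _ =>
          Finset.prod_add_prod_eq (Finset.mem_univ q) ?_ ?_ ?_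
        · simp [h, w, q]
          ring
        · intro j _ hj
          have : ((j : ℕ) < k + 1) ↔ (j : ℕ) < k := by
            have : (j : ℕ) ≠ k := fun h => hj (Fin.ext h)
            omega
          simp only [w, h, if_neg hj, this]
        · intro j _ hj
          simp only [w, if_neg hj]
      rw [hw] at hadd
      exact CharTwo.add_eq_zero.1 hadd
  rw [← key N le_rfl]
  simp [h]


/-- The sign labelling of a vector-valued map on lattice points, with ties on the boundary broken
by the lexicographic order. -/
noncomputable def signLabel (M : ℕ) (g : (Fin N → ℤ) → Fin N → ℝ) (i : Fin N) (x : Fin N → ℤ) :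
    ZMod 2 :=
  open Classical in
  if g x i < 0 ∨ (IsBoundary M x ∧ g x i = 0 ∧ toLex x < 0) then 1 else 0

lemma signLabel_neg_of_odd {M : ℕ} {g : (Fin N → ℤ) → Fin N → ℝ} {x : Fin N → ℤ}
    (hx : IsBoundary M x) (h : g (-x) = -g x) (i : Fin N) :
    signLabel M g i (-x) = signLabel M g i x + 1 := by
  have hx' : IsBoundary M (-x) := by simpa [IsBoundary] using hx
  have h0 : toLex x ≠ 0 := by
    obtain ⟨c, hc⟩ := hx.2
    intro h
    have : x c = 0 := congrFun (congrArg ofLex h) c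
    simp [this] at hc
    omega
  have hlex : toLex (-x) < 0 ↔ ¬ toLex x < 0 := by
    rw [toLex_neg, neg_lt_zero]
    exact ⟨fun h => h.not_gt, fun h => (not_lt.1 h).lt_of_ne' h0⟩
  have e : (1 : ZMod 2) + 1 = 0 := by decide
  have key : (g (-x) i < 0 ∨ (IsBoundary M (-x) ∧ g (-x) i = 0 ∧ toLex (-x) < 0)) ↔
      ¬ (g x i < 0 ∨ (IsBoundary M x ∧ g x i = 0 ∧ toLex x < 0)) := by
    rw [hlex, h, Pi.neg_apply]
    rcases lt_trichotomy (g x i) 0 with h1 | h1 | h1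
    · simp [h1, h1.le, h1.ne]
    · simp [h1, hx, hx']
    · simp [h1, h1.ne', h1.not_gt]
  by_cases hp : g x i < 0 ∨ (IsBoundary M x ∧ g x i = 0 ∧ toLex x < 0)
  · rw [signLabel, signLabel, if_pos hp, if_neg fun h => key.1 h hp, e]
  · rw [signLabel, signLabel, if_neg hp, if_pos (key.2 hp), zero_add]

lemma signLabel_neg_of_even {M : ℕ} {g : (Fin N → ℤ) → Fin N → ℝ} {x : Fin N → ℤ}
    (hx : ¬ IsBoundary M x) (h : g (-x) = g x) (i : Fin N) :
    signLabel M g i (-x) = signLabel M g i x := by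
  have hx' : ¬ IsBoundary M (-x) := by simpa [IsBoundary] using hx
  simp [signLabel, hx, hx', h]

lemma nonpos_of_signLabel_eq_one {M : ℕ} {g : (Fin N → ℤ) → Fin N → ℝ} {x : Fin N → ℤ}
    {i : Fin N} (h : signLabel M g i x = 1) : g x i ≤ 0 := by
  by_contra! hlt
  simp [signLabel, hlt.not_gt, hlt.ne'] at h

lemma nonneg_of_signLabel_eq_zero {M : ℕ} {g : (Fin N → ℤ) → Fin N → ℝ} {x : Fin N → ℤ}
    {i : Fin N} (h : signLabel M g i x = 0) : 0 ≤ g x i := by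
  by_contra! hlt
  simp [signLabel, hlt] at h

lemma signs_of_signLabel_add_ne_zero {M : ℕ} {g : (Fin N → ℤ) → Fin N → ℝ} {x y : Fin N → ℤ}
    {i : Fin N} (h : signLabel M g i x + signLabel M g i y ≠ 0) :
    (g x i ≤ 0 ∧ 0 ≤ g y i) ∨ (0 ≤ g x i ∧ g y i ≤ 0) := by
  have e : ∀ a b : ZMod 2, a + b ≠ 0 → (a = 1 ∧ b = 0) ∨ (a = 0 ∧ b = 1) := by decide
  rcases e _ _ h with ⟨h1, h2⟩ | ⟨h1, h2⟩
  · exact .inl ⟨nonpos_of_signLabel_eq_one h1, nonneg_of_signLabel_eq_zero h2⟩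
  · exact .inr ⟨nonneg_of_signLabel_eq_zero h1, nonpos_of_signLabel_eq_one h2⟩

lemma changeCount_signLabel_id {M : ℕ} (hM : 0 < M) :
    changeCount M (signLabel (N := N) M fun x i => (x i : ℝ)) = 1 := by
  have hlabel (σ : Flag N) (h' : ∀ c, ∃ k, |vertex σ k c| ≤ 1) (i : Fin N) (j : ℕ) :
      signLabel M (fun x i => (x i : ℝ)) i (vertex σ j) = if vertex σ j i < 0 then 1 else 0 := by
    have hb : ¬ IsBoundary M (vertex σ j) := by
      rintro ⟨-, c, hc⟩
      obtain ⟨k, hk⟩ := h' c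
      have := abs_le.1 (abs_vertex_sub_le σ j k c)
      have := abs_le.1 hk
      have : |vertex σ j c| ≤ 2 := abs_le.2 ⟨by omega, by omega⟩
      omega
    simp [signLabel, hb]
  rw [changeCount, Finset.sum_eq_single ((0, 1, -1) : Flag N)]
  · apply Finset.prod_eq_one
    intro i _
    have h0 (c : Fin N) (k : ℕ) : |vertex ((0, 1, -1) : Flag N) k c| ≤ 1 := by
      simp only [vertex]
      split_ifs <;> simp
    rw [hlabel _ fun c => ⟨0, h0 c 0⟩, hlabel _ fun c => ⟨0, h0 c 0⟩]
    simp [vertex]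
  · intro σ _ hσ
    by_contra hne
    apply hσ
    have hch (i : Fin N) := Finset.prod_ne_zero_iff.1 hne i (Finset.mem_univ i)
    have hsm (i : Fin N) : |vertex σ i i| ≤ 1 := by
      have h1 := abs_le.1 (abs_vertex_sub_le σ i (i + 1) i)
      rw [abs_le]
      rcases signs_of_signLabel_add_ne_zero (hch i) with ⟨h2, h3⟩ | ⟨h2, h3⟩ <;>
        norm_cast at h2 h3 <;> omega
    have hch' (i : Fin N) : (σ.2.1 i : ℕ) = i ∧ σ.1 i = 0 ∧ σ.2.2 i = -1 := by
      have h1 := hch i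
      rw [hlabel _ fun c => ⟨c, hsm c⟩, hlabel _ fun c => ⟨c, hsm c⟩] at h1
      have e : (1 : ZMod 2) + 1 = 0 := by decide
      simp only [vertex] at h1
      rcases lt_trichotomy (σ.2.1 i : ℕ) i with h2 | h2 | h2
      · simp only [h2, if_true, show (σ.2.1 i : ℕ) < i + 1 by omega] at h1
        split_ifs at h1 <;> simp [e] at h1
      · refine ⟨h2, ?_⟩
        simp only [h2, lt_irrefl, if_false, show (i : ℕ) < i + 1 by omega, if_true] at h1
        rcases Int.units_eq_one_or (σ.2.2 i) with h3 | h3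
        · simp only [h3, Units.val_one] at h1
          split_ifs at h1 <;> first | omega | simp [e] at h1
        · simp only [h3, Units.val_neg, Units.val_one] at h1
          refine ⟨?_, h3⟩
          split_ifs at h1 <;> first | omega | simp [e] at h1
      · simp only [show ¬ (σ.2.1 i : ℕ) < i by omega, if_false,
          show ¬ (σ.2.1 i : ℕ) < i + 1 by omega] at h1
        split_ifs at h1 <;> simp [e] at h1
    refine Prod.ext (funext fun i => (hch' i).2.1) (Prod.ext ?_ (funext fun i => (hch' i).2.2))
    ext i
    exact (hch' i).1
  · intro h
    exact absurd (mem_flags.2 (by simp)) h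

end UnionJack

open UnionJack in
/-- A continuous map on the punctured space that is even on the unit ball and odd on the sphere of
radius two has a zero. -/
theorem exists_zero_of_even_of_odd {N : ℕ} (hN : 0 < N) {G : (Fin N → ℝ) → Fin N → ℝ}
    (hG : ContinuousOn G {0}ᶜ) (heven : ∀ x, ‖x‖ ≤ 1 → G (-x) = G x)
    (hodd : ∀ x, ‖x‖ = 2 → G (-x) = -G x) : ∃ x, x ≠ 0 ∧ ‖x‖ ≤ 2 ∧ G x = 0 := by
  by_contra! hne
  let A : Set (Fin N → ℝ) := Metric.closedBall 0 2 \ Metric.ball 0 (1 / 2)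
  have hA : IsCompact A := (isCompact_closedBall _ _).diff Metric.isOpen_ball
  have hmemA {x : Fin N → ℝ} : x ∈ A ↔ ‖x‖ ≤ 2 ∧ 1 / 2 ≤ ‖x‖ := by simp [A]
  have hA0 : A ⊆ {0}ᶜ := by
    intro x hx h0
    rw [Set.mem_singleton_iff] at h0
    have := (hmemA.1 hx).2
    simp [h0] at this
    norm_num at this
  have hGA : ContinuousOn G A := hG.mono hA0
  obtain ⟨ε, hε, hεA⟩ := hA.exists_forall_le' (a := 0) hGA.norm
    fun x hx => norm_pos_iff.2 (hne x (hA0 hx) (hmemA.1 hx).1)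
  obtain ⟨δ, hδ, hδA⟩ :=
    Metric.uniformContinuousOn_iff.1 (hA.uniformContinuousOn_of_continuous hGA) ε hε
  obtain ⟨M, hM⟩ := exists_nat_gt (max (4 : ℝ) (2 / δ))
  rw [max_lt_iff] at hM
  have hM0 : 0 < M := by
    have : (0 : ℝ) < M := by linarith
    exact_mod_cast this
  have hK : (0 : ℝ) < 2 * M + 1 := by positivity
  have hmesh : 2 / (2 * (M : ℝ) + 1) < δ := by
    rw [div_lt_iff₀ hK]
    have := (div_lt_iff₀ hδ).1 hM.2
    nlinarith
  have hmesh' : 2 / (2 * (M : ℝ) + 1) ≤ 1 / 2 := by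
    rw [div_le_iff₀ hK]
    linarith
  let p (x : Fin N → ℤ) : Fin N → ℝ := fun c => 2 / (2 * M + 1) * x c
  have hpneg (x : Fin N → ℤ) : p (-x) = -p x := by
    funext c
    simp [p]
  have hpdist {x y : Fin N → ℤ} (h : ∀ c, |x c - y c| ≤ 1) : dist (p x) (p y) ≤ 2 / (2 * M + 1) := by
    rw [dist_pi_le_iff (by positivity)]
    intro c
    rw [Real.dist_eq, ← mul_sub, abs_mul, abs_of_pos (by positivity)]
    have h1 : |(x c : ℝ) - y c| ≤ 1 := by exact_mod_cast h c
    exact mul_le_of_le_one_right (by positivity) h1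
  have hple {x : Fin N → ℤ} (h : ∀ c, |x c| ≤ 2 * M + 1) : ‖p x‖ ≤ 2 := by
    rw [pi_norm_le_iff_of_nonneg (by norm_num)]
    intro c
    have h1 : |(x c : ℝ)| ≤ 2 * M + 1 := by exact_mod_cast h c
    rw [Real.norm_eq_abs, abs_mul, abs_of_pos (by positivity), div_mul_eq_mul_div,
      div_le_iff₀ hK]
    linarith
  have hpb {x : Fin N → ℤ} (h : IsBoundary M x) : ‖p x‖ = 2 := by
    refine (hple h.1).antisymm ?_
    obtain ⟨c, hc⟩ := h.2
    have h1 : |(x c : ℝ)| = 2 * M + 1 := by exact_mod_cast hc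
    refine le_trans ?_ (norm_le_pi_norm (p x) c)
    rw [Real.norm_eq_abs, abs_mul, abs_of_pos (by positivity), h1, div_mul_cancel₀ _ hK.ne']
  let g (x : Fin N → ℤ) : Fin N → ℝ := G (p x)
  have h1 : changeCount M (signLabel M g) = 1 := by
    rw [← changeCount_signLabel_id hM0]
    apply changeCount_congr
    · intro i x hx
      refine signLabel_neg_of_odd hx ?_ i
      simp only [g, hpneg]
      exact hodd _ (hpb hx)
    · intro i x hx
      refine signLabel_neg_of_odd hx ?_ i
      funext c
      simp
  have houter (σ : Flag N) (hσ : σ ∈ flags N M) (j : ℕ) (hj : 1 < ‖p (vertex σ j)‖) :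
      ∏ i : Fin N, (signLabel M g i (vertex σ i) + signLabel M g i (vertex σ (i + 1))) = 0 := by
    by_contra hprod
    have hdist (k : ℕ) : dist (p (vertex σ k)) (p (vertex σ j)) ≤ 2 / (2 * M + 1) :=
      hpdist fun c => abs_vertex_sub_le σ k j c
    have hmem (k : ℕ) : p (vertex σ k) ∈ A := by
      refine hmemA.2 ⟨hple (abs_vertex_le hσ k), ?_⟩
      have h2 := hdist k
      rw [dist_comm, dist_eq_norm] at h2
      have h3 := norm_sub_norm_le (p (vertex σ j)) (p (vertex σ k))
      linarith
    have hlt : ‖G (p (vertex σ j))‖ < ε := by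
      rw [pi_norm_lt_iff hε]
      intro i
      have hclose (k : ℕ) : |G (p (vertex σ k)) i - G (p (vertex σ j)) i| < ε := by
        have h2 := hδA _ (hmem k) _ (hmem j) ((hdist k).trans_lt hmesh)
        exact (dist_le_pi_dist _ _ i).trans_lt h2
      have h2 := abs_lt.1 (hclose i)
      have h3 := abs_lt.1 (hclose (i + 1))
      rw [Real.norm_eq_abs, abs_lt]
      rcases signs_of_signLabel_add_ne_zero
        (Finset.prod_ne_zero_iff.1 hprod i (Finset.mem_univ i)) with ⟨h4, h5⟩ | ⟨h4, h5⟩ <;>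
        constructor <;> linarith
    exact absurd (hεA _ (hmem j)) (not_le.2 hlt)
  have h0 : changeCount M (signLabel M g) = 0 := by
    refine Finset.sum_involution (fun σ _ => antipode σ) ?_ (fun σ _ _ => antipode_ne hN σ)
      (fun σ hσ => antipode_mem hσ) (fun σ _ => antipode_antipode σ)
    intro σ hσ
    by_cases hin : ∀ j, ‖p (vertex σ j)‖ ≤ 1
    · have hev (i : Fin N) (j : ℕ) :
          signLabel M g i (vertex (antipode σ) j) = signLabel M g i (vertex σ j) := by
        rw [vertex_antipode]
        refine signLabel_neg_of_even (fun hb => ?_) ?_ i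
        · have h2 := hpb hb
          have h3 := hin j
          linarith
        · simp only [g, hpneg]
          exact heven _ (hin j)
      simp only [hev, CharTwo.add_self_eq_zero]
    · push Not at hin
      obtain ⟨j, hj⟩ := hin
      rw [houter σ hσ j hj, houter (antipode σ) (antipode_mem hσ) j, add_zero]
      rwa [vertex_antipode, hpneg, norm_neg]
  exact zero_ne_one (h0.symm.trans h1)

/-- Antitone functions depending continuously on a parameter that is treated evenly on the unit
ball and oddly on the sphere of radius two can be equalised by a choice of the parameter. -/
theorem exists_common_value_of_even_of_odd {N : ℕ} (hN : 0 < N)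
    {Ψ : Fin (N + 1) → (Fin N → ℝ) → ℝ → ℝ}
    (hx : ∀ i, ∀ τ ∈ Set.Icc (-1 : ℝ) 1, ContinuousOn (fun x => Ψ i x τ) {0}ᶜ)
    (hτ : ∀ i x, x ≠ 0 → ContinuousOn (Ψ i x) (Set.Icc (-1) 1))
    (hanti : ∀ i x, x ≠ 0 → AntitoneOn (Ψ i x) (Set.Icc (-1) 1))
    (hneg : ∀ i x, x ≠ 0 → 0 ≤ Ψ i x (-1)) (hpos : ∀ i x, x ≠ 0 → Ψ i x 1 ≤ 0)
    (heven : ∀ i x τ, ‖x‖ ≤ 1 → Ψ i (-x) τ = Ψ i x τ)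
    (hodd : ∀ i x τ, ‖x‖ = 2 → Ψ i (-x) (-τ) = -Ψ i x τ) {ε : ℝ} (hε : 0 < ε) :
    ∃ x, x ≠ 0 ∧ ‖x‖ ≤ 2 ∧ ∃ τ ∈ Set.Icc (-1 : ℝ) 1, ∀ i, Ψ i x τ = ε * τ := by
  have hstrict (i) {x : Fin N → ℝ} (h0 : x ≠ 0) :
      StrictAntiOn (fun τ => Ψ i x τ - ε * τ) (Set.Icc (-1) 1) := by
    intro s hs t ht hst
    have h1 := hanti i x h0 hs ht hst.le
    have h2 := mul_lt_mul_of_pos_left hst hε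
    dsimp only
    linarith
  have hex (i) (x : Fin N → ℝ) :
      ∃ τ ∈ Set.Icc (-1 : ℝ) 1, x ≠ 0 → Ψ i x τ - ε * τ = 0 := by
    by_cases h0 : x = 0
    · exact ⟨0, by norm_num, fun h => absurd h0 h⟩
    have hc : ContinuousOn (fun τ => Ψ i x τ - ε * τ) (Set.Icc (-1) 1) :=
      (hτ i x h0).sub (by fun_prop)
    obtain ⟨τ, hτ, h⟩ := intermediate_value_Icc' (by norm_num) hc
      (show (0 : ℝ) ∈ Set.Icc _ _ from
        ⟨by linarith [hpos i x h0], by linarith [hneg i x h0]⟩)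
    exact ⟨τ, hτ, fun _ => h⟩
  choose m hm hm0 using hex
  have huniq (i) {x : Fin N → ℝ} (h0 : x ≠ 0) {τ : ℝ} (hτ : τ ∈ Set.Icc (-1 : ℝ) 1)
      (h : Ψ i x τ - ε * τ = 0) : m i x = τ :=
    (hstrict i h0).injOn (hm i x) hτ ((hm0 i x h0).trans h.symm)
  have hmc (i) : ContinuousOn (m i) {0}ᶜ := by
    intro x h0
    have hev : ∀ᶠ y in nhdsWithin x {0}ᶜ, y ≠ 0 := eventually_mem_nhdsWithin
    refine tendsto_order.2 ⟨fun a ha => ?_, fun a ha => ?_⟩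
    · by_cases h1 : a < -1
      · exact Filter.Eventually.of_forall fun y => h1.trans_le (hm i y).1
      have haI : a ∈ Set.Icc (-1 : ℝ) 1 := ⟨not_lt.1 h1, ha.le.trans (hm i x).2⟩
      have h2 : 0 < Ψ i x a - ε * a := (hm0 i x h0).symm.trans_lt (hstrict i h0 haI (hm i x) ha)
      have h3 : ContinuousWithinAt (fun y => Ψ i y a - ε * a) {0}ᶜ x :=
        (hx i a haI x h0).sub continuousWithinAt_const
      filter_upwards [h3.eventually_const_lt h2, hev] with y hy hy0
      by_contra! hle
      have h4 := (hstrict i hy0).antitoneOn (hm i y) haI hle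
      rw [hm0 i y hy0] at h4
      linarith
    · by_cases h1 : 1 < a
      · exact Filter.Eventually.of_forall fun y => (hm i y).2.trans_lt h1
      have haI : a ∈ Set.Icc (-1 : ℝ) 1 := ⟨(hm i x).1.trans ha.le, not_lt.1 h1⟩
      have h2 : Ψ i x a - ε * a < 0 := (hstrict i h0 (hm i x) haI ha).trans_eq (hm0 i x h0)
      have h3 : ContinuousWithinAt (fun y => Ψ i y a - ε * a) {0}ᶜ x :=
        (hx i a haI x h0).sub continuousWithinAt_const
      filter_upwards [h3.eventually_lt_const h2, hev] with y hy hy0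
      by_contra! hle
      have h4 := (hstrict i hy0).antitoneOn haI (hm i y) hle
      rw [hm0 i y hy0] at h4
      linarith
  have hmeven (i) (x : Fin N → ℝ) (h : ‖x‖ ≤ 1) : m i (-x) = m i x := by
    by_cases h0 : x = 0
    · simp [h0]
    refine huniq i (neg_ne_zero.2 h0) (hm i x) ?_
    rw [heven i x _ h, hm0 i x h0]
  have hmodd (i) (x : Fin N → ℝ) (h : ‖x‖ = 2) : m i (-x) = -m i x := by
    have h0 : x ≠ 0 := by
      rintro rfl
      simp at h
    refine huniq i (neg_ne_zero.2 h0) ⟨neg_le_neg (hm i x).2, neg_le.1 (hm i x).1⟩ ?_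
    rw [hodd i x _ h]
    linarith [hm0 i x h0]
  obtain ⟨x, h0, hx2, hG⟩ := exists_zero_of_even_of_odd hN
    (G := fun x j => m j.castSucc x - m (Fin.last N) x)
    (continuousOn_pi.2 fun j => (hmc _).sub (hmc _))
    (fun x h => by simp only [hmeven _ x h])
    (fun x h => by
      funext j
      simp only [hmodd _ x h, Pi.neg_apply]
      ring)
  refine ⟨x, h0, hx2, m (Fin.last N) x, hm _ x, fun i => ?_⟩
  have hi : m i x = m (Fin.last N) x := by
    refine Fin.lastCases rfl (fun j => ?_) i
    exact sub_eq_zero.1 (congrFun hG j)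
  have := hm0 i x h0
  rw [hi] at this
  linarith

section LineMeasures

variable {E : Type*} [NormedAddCommGroup E] [InnerProductSpace ℝ E]

/-- For a line `p + ℝu` this has the sign of `t - h`, where `t` is the height at which the line
meets the vertical hyperplane `⟪x, v⟫ = c` if `a = 1`, and the vertical speed of the line in
direction `v` if `a = 0` and `c = 1`; it vanishes if the line is parallel to the hyperplane. -/
def heightForm (e v : E) (a c h : ℝ) (w : E × Metric.sphere (0 : E) 1) : ℝ :=
  ⟪(w.2 : E), v⟫ * (a * (⟪w.1, e⟫ * ⟪(w.2 : E), v⟫ - ⟪(w.2 : E), e⟫ * ⟪w.1, v⟫) +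
    c * ⟪(w.2 : E), e⟫ - h * ⟪(w.2 : E), v⟫)

lemma continuous_heightForm (e v : E) (a c h : ℝ) : Continuous (heightForm e v a c h) := by
  unfold heightForm
  fun_prop

lemma continuous_heightForm_parameters (e : E) (w : E × Metric.sphere (0 : E) 1) :
    Continuous fun q : E × ℝ × ℝ × ℝ => heightForm e q.1 q.2.1 q.2.2.1 q.2.2.2 w := by
  unfold heightForm
  fun_prop

lemma heightForm_smul (e v : E) (t a c h : ℝ) (w : E × Metric.sphere (0 : E) 1) :
    heightForm e v (t * a) (t * c) (t * h) w = t * heightForm e v a c h w := by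
  simp only [heightForm]
  ring

lemma heightForm_neg_even (e v : E) (a h : ℝ) (w : E × Metric.sphere (0 : E) 1) :
    heightForm e (-v) a 0 h w = heightForm e v a 0 h w := by
  simp only [heightForm, inner_neg_right]
  ring

lemma heightForm_neg_odd (e v : E) (c h : ℝ) (w : E × Metric.sphere (0 : E) 1) :
    heightForm e (-v) 0 c (-h) w = -heightForm e v 0 c h w := by
  simp only [heightForm, inner_neg_right]
  ring

/-- Heights are compactified by a parameter `τ ∈ [-1, 1]`; the form is antitone in it up to a
nonnegative factor. -/
lemma heightForm_comparison (e v : E) (a c : ℝ) (w : E × Metric.sphere (0 : E) 1) {s t : ℝ}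
    (hs : s ∈ Set.Icc (-1 : ℝ) 1) (ht : t ∈ Set.Icc (-1 : ℝ) 1) (hst : s ≤ t) :
    (0 < heightForm e v ((1 - |t|) * a) ((1 - |t|) * c) t w →
      0 < heightForm e v ((1 - |s|) * a) ((1 - |s|) * c) s w) ∧
    (heightForm e v ((1 - |s|) * a) ((1 - |s|) * c) s w < 0 →
      heightForm e v ((1 - |t|) * a) ((1 - |t|) * c) t w < 0) := by
  have key (τ : ℝ) : heightForm e v ((1 - |τ|) * a) ((1 - |τ|) * c) τ w =
      (1 - |τ|) * heightForm e v a c 0 w - τ * ⟪(w.2 : E), v⟫ ^ 2 := by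
    simp only [heightForm]
    ring
  have h0 : ⟪(w.2 : E), v⟫ ^ 2 = 0 → heightForm e v a c 0 w = 0 := by
    intro h
    simp [heightForm, pow_eq_zero_iff two_ne_zero |>.1 h]
  rw [key, key]
  generalize heightForm e v a c 0 w = X at *
  have hY : 0 ≤ ⟪(w.2 : E), v⟫ ^ 2 := sq_nonneg _
  generalize ⟪(w.2 : E), v⟫ ^ 2 = Y at *
  rcases hY.eq_or_lt with rfl | hY
  · simp [h0 rfl]
  have hgs : 0 ≤ 1 - |s| := sub_nonneg.2 (abs_le.2 hs)
  have hgt : 0 ≤ 1 - |t| := sub_nonneg.2 (abs_le.2 ht)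
  have hcross : s * (1 - |t|) ≤ t * (1 - |s|) := by
    rcases abs_cases s with ⟨h1, h2⟩ | ⟨h1, h2⟩ <;> rcases abs_cases t with ⟨h3, h4⟩ | ⟨h3, h4⟩ <;>
      rw [h1, h3] <;> nlinarith
  have hle : (1 - |s|) * ((1 - |t|) * X - t * Y) ≤ (1 - |t|) * ((1 - |s|) * X - s * Y) := by
    nlinarith [mul_le_mul_of_nonneg_right hcross hY.le]
  constructor
  · intro h
    rcases hgs.eq_or_lt with h1 | h1
    · have hs1 : s = -1 := by
        rcases abs_cases s with ⟨h2, h3⟩ | ⟨h2, h3⟩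
        · have : s = 1 := by linarith
          have : t = 1 := le_antisymm ht.2 (this ▸ hst)
          subst this
          norm_num at h
          linarith
        · linarith
      rw [← h1, hs1]
      linarith
    · exact pos_of_mul_pos_right ((mul_pos h1 h).trans_le hle) hgt
  · intro h
    rcases hgt.eq_or_lt with h1 | h1
    · have ht1 : t = 1 := by
        rcases abs_cases t with ⟨h2, h3⟩ | ⟨h2, h3⟩
        · linarith
        · have : t = -1 := by linarith
          have : s = -1 := le_antisymm (this ▸ hst) hs.1
          subst this
          norm_num at h
          linarith
      rw [← h1, ht1]
      linarith
    · by_contra! hn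
      have := mul_nonneg hgs hn
      have := mul_neg_of_pos_of_neg h1 h
      linarith

variable [MeasurableSpace E]

/-- The measure of the lines lying above minus that of the lines lying below. -/
noncomputable def balance (μ : Measure (E × Metric.sphere (0 : E) 1)) (e v : E) (a c h : ℝ) : ℝ :=
  μ.real {w | 0 < heightForm e v a c h w} - μ.real {w | heightForm e v a c h w < 0}

section Balance

variable (μ : Measure (E × Metric.sphere (0 : E) 1)) (e v : E)

lemma balance_smul {t : ℝ} (ht : 0 < t) (a c h : ℝ) :
    balance μ e v (t * a) (t * c) (t * h) = balance μ e v a c h := by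
  simp only [balance, heightForm_smul, mul_pos_iff_of_pos_left ht, mul_neg_iff, ht, ht.not_gt,
    true_and, false_and, or_false]

lemma balance_neg_even (a h : ℝ) : balance μ e (-v) a 0 h = balance μ e v a 0 h := by
  simp only [balance, heightForm_neg_even]

lemma balance_neg_odd (c h : ℝ) : balance μ e (-v) 0 c (-h) = -balance μ e v 0 c h := by
  simp only [balance, heightForm_neg_odd, neg_pos, neg_neg_iff_pos, neg_sub]

lemma balance_top : balance μ e v 0 0 1 = -μ.real {w | ⟪(w.2 : E), v⟫ ≠ 0} := by
  have h1 (w : E × Metric.sphere (0 : E) 1) : heightForm e v 0 0 1 w = -⟪(w.2 : E), v⟫ ^ 2 := by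
    simp only [heightForm]
    ring
  simp only [balance, h1, neg_pos, neg_neg_iff_pos, sq_pos_iff, (sq_nonneg _).not_gt,
    Set.ofPred_false, measureReal_empty, zero_sub]

lemma balance_bot : balance μ e v 0 0 (-1) = μ.real {w | ⟪(w.2 : E), v⟫ ≠ 0} := by
  have h1 (w : E × Metric.sphere (0 : E) 1) : heightForm e v 0 0 (-1) w = ⟪(w.2 : E), v⟫ ^ 2 := by
    simp only [heightForm]
    ring
  simp only [balance, h1, sq_pos_iff, (sq_nonneg _).not_gt, Set.ofPred_false, measureReal_empty,
    sub_zero]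

lemma balance_antitoneOn [IsFiniteMeasure μ] (a c : ℝ) :
    AntitoneOn (fun τ => balance μ e v ((1 - |τ|) * a) ((1 - |τ|) * c) τ) (Set.Icc (-1) 1) := by
  intro s hs t ht hst
  exact sub_le_sub
    (measureReal_mono fun w => (heightForm_comparison e v a c w hs ht hst).1)
    (measureReal_mono fun w => (heightForm_comparison e v a c w hs ht hst).2)

variable {μ e v}

lemma measure_ge_eq_measure_le_of_balance_eq_zero [IsFiniteMeasure μ] {a c h t : ℝ}
    (hne : ∀ᵐ w ∂μ, heightForm e v a c h w ≠ 0) (h0 : balance μ e v a c h = 0)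
    {g : E × Metric.sphere (0 : E) 1 → ℝ}
    (hg : ∀ w, ⟪(w.2 : E), v⟫ ≠ 0 → heightForm e v a c h w = ⟪(w.2 : E), v⟫ ^ 2 * (g w - t)) :
    μ {w | ⟪(w.2 : E), v⟫ ≠ 0 ∧ g w ≥ t} = μ {w | ⟪(w.2 : E), v⟫ ≠ 0 ∧ g w ≤ t} := by
  have h1 : {w | ⟪(w.2 : E), v⟫ ≠ 0 ∧ g w ≥ t} =ᵐ[μ] {w | 0 < heightForm e v a c h w} := by
    filter_upwards [hne] with w hw
    have hu : ⟪(w.2 : E), v⟫ ≠ 0 := left_ne_zero_of_mul hw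
    rw [hg w hu] at hw
    refine propext (Iff.trans ?_ (show 0 < heightForm e v a c h w ↔ _ from Iff.rfl))
    rw [hg w hu, mul_pos_iff_of_pos_left (by positivity), sub_pos]
    exact ⟨fun h => h.2.lt_of_ne' (sub_ne_zero.1 (right_ne_zero_of_mul hw)),
      fun h => ⟨hu, h.le⟩⟩
  have h2 : {w | ⟪(w.2 : E), v⟫ ≠ 0 ∧ g w ≤ t} =ᵐ[μ] {w | heightForm e v a c h w < 0} := by
    filter_upwards [hne] with w hw
    have hu : ⟪(w.2 : E), v⟫ ≠ 0 := left_ne_zero_of_mul hw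
    rw [hg w hu] at hw
    refine propext (Iff.trans ?_ (show heightForm e v a c h w < 0 ↔ _ from Iff.rfl))
    rw [hg w hu, ← neg_pos, ← mul_neg, mul_pos_iff_of_pos_left (by positivity), neg_pos, sub_neg]
    exact ⟨fun h => h.2.lt_of_ne (sub_ne_zero.1 (right_ne_zero_of_mul hw)),
      fun h => ⟨hu, h.le⟩⟩
  rw [measure_congr h1, measure_congr h2]
  exact (measureReal_eq_measureReal_iff).1 (sub_eq_zero.1 h0)

end Balance

variable [FiniteDimensional ℝ E] [BorelSpace E]

open scoped Pointwise in
lemma toSphere_inner_eq_zero {k : E} (hk : k ≠ 0) :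
    (volume : Measure E).toSphere {u | ⟪(u : E), k⟫ = 0} = 0 := by
  have hcont : Continuous fun u : Metric.sphere (0 : E) 1 => ⟪(u : E), k⟫ := by fun_prop
  have hm : MeasurableSet {u : Metric.sphere (0 : E) 1 | ⟪(u : E), k⟫ = 0} :=
    (isClosed_eq hcont continuous_const).measurableSet
  rw [Measure.toSphere_apply' _ hm]
  have hsub : Set.Ioo (0 : ℝ) 1 • Set.image (↑) {u : Metric.sphere (0 : E) 1 | ⟪(u : E), k⟫ = 0} ⊆
      ((innerₛₗ ℝ k).ker : Set E) := by
    rintro _ ⟨t, -, _, ⟨u, hu, rfl⟩, rfl⟩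
    have hu' : ⟪k, (u : E)⟫ = 0 := by rwa [real_inner_comm]
    simp [hu']
  have hker : (innerₛₗ ℝ k).ker ≠ ⊤ := by
    intro h
    have : k ∈ (innerₛₗ ℝ k).ker := h ▸ Submodule.mem_top
    simp [hk] at this
  rw [measure_mono_null hsub (Measure.addHaar_submodule _ _ hker), mul_zero]

lemma volume_inner_eq {k : E} (hk : k ≠ 0) (b : ℝ) :
    (volume : Measure E) {p | ⟪p, k⟫ = b} = 0 := by
  have hker : (innerₛₗ ℝ k).ker ≠ ⊤ := by
    intro h
    have : k ∈ (innerₛₗ ℝ k).ker := h ▸ Submodule.mem_top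
    simp [hk] at this
  rcases Set.eq_empty_or_nonempty {p : E | ⟪p, k⟫ = b} with h | ⟨p₀, hp₀⟩
  · simp [h]
  have heq : {p : E | ⟪p, k⟫ = b} = (fun p => p + -p₀) ⁻¹' ((innerₛₗ ℝ k).ker : Set E) := by
    ext p
    rw [Set.mem_ofPred_eq, real_inner_comm] at hp₀
    simp only [Set.mem_ofPred_eq, Set.mem_preimage, SetLike.mem_coe, LinearMap.mem_ker,
      innerₛₗ_apply_apply, inner_add_right, inner_neg_right]
    rw [hp₀, real_inner_comm]
    constructor <;> intro h <;> linarith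
  rw [heq, measure_preimage_add_right, Measure.addHaar_submodule _ _ hker]

lemma ae_heightForm_ne_zero {e v : E} (he : ‖e‖ = 1) (hv : ‖v‖ = 1) (hve : ⟪v, e⟫ = 0)
    {a c h : ℝ} (hach : (a, c, h) ≠ 0) :
    ∀ᵐ w ∂(volume : Measure E).prod (volume : Measure E).toSphere,
      heightForm e v a c h w ≠ 0 := by
  have hv0 : v ≠ 0 := by
    rintro rfl
    simp at hv
  have hvv : ⟪v, v⟫ = 1 := by rw [real_inner_self_eq_norm_sq, hv, one_pow]
  have hee : ⟪e, e⟫ = 1 := by rw [real_inner_self_eq_norm_sq, he, one_pow]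
  have hev : ⟪e, v⟫ = 0 := by rwa [real_inner_comm]
  have hm : MeasurableSet {w | heightForm e v a c h w = 0} :=
    (isClosed_eq (continuous_heightForm e v a c h) continuous_const).measurableSet
  rw [ae_iff]
  simp only [ne_eq, not_not]
  rw [Measure.prod_apply_symm hm, lintegral_eq_zero_iff (measurable_measure_prodMk_right hm)]
  have hu : ∀ᵐ u : Metric.sphere (0 : E) 1 ∂(volume : Measure E).toSphere, ⟪(u : E), v⟫ ≠ 0 := by
    rw [ae_iff]
    simpa using toSphere_inner_eq_zero hv0
  by_cases ha : a = 0
  · have hk : c • e - h • v ≠ 0 := by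
      intro h0
      have h1 : ⟪c • e - h • v, e⟫ = 0 := by rw [h0, inner_zero_left]
      have h2 : ⟪c • e - h • v, v⟫ = 0 := by rw [h0, inner_zero_left]
      simp only [inner_sub_left, real_inner_smul_left, hee, hev, hve, hvv] at h1 h2
      apply hach
      ext <;> simp <;> linarith
    have hu' : ∀ᵐ u : Metric.sphere (0 : E) 1 ∂(volume : Measure E).toSphere,
        ⟪(u : E), c • e - h • v⟫ ≠ 0 := by
      rw [ae_iff]
      simpa using toSphere_inner_eq_zero hk
    filter_upwards [hu, hu'] with u h1 h2
    refine measure_mono_null (t := ∅) (fun p hp => h2 ?_) measure_empty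
    have hp' : heightForm e v a c h (p, u) = 0 := hp
    simp only [heightForm, mul_eq_zero, h1, false_or, ha, zero_mul, zero_add] at hp'
    rwa [inner_sub_right, inner_smul_right, inner_smul_right]
  · filter_upwards [hu] with u h1
    have hk : a • (⟪(u : E), v⟫ • e - ⟪(u : E), e⟫ • v) ≠ 0 := by
      intro h0
      have h2 : ⟪a • (⟪(u : E), v⟫ • e - ⟪(u : E), e⟫ • v), e⟫ = 0 := by
        rw [h0, inner_zero_left]
      simp [inner_sub_left, real_inner_smul_left, hve, ha, h1] at h2
      simp [h2] at he
    refine measure_mono_null ?_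
      (volume_inner_eq hk (h * ⟪(u : E), v⟫ - c * ⟪(u : E), e⟫))
    intro p hp
    have hp' : heightForm e v a c h (p, u) = 0 := hp
    simp only [heightForm, mul_eq_zero, h1, false_or] at hp'
    simp only [Set.mem_ofPred_eq, inner_smul_right, inner_sub_right]
    linarith

lemma continuousAt_balance {μ : Measure (E × Metric.sphere (0 : E) 1)} [IsFiniteMeasure μ] {e v : E}
    {a c h : ℝ} (hne : ∀ᵐ w ∂μ, heightForm e v a c h w ≠ 0) :
    ContinuousAt (fun q : E × ℝ × ℝ × ℝ => balance μ e q.1 q.2.1 q.2.2.1 q.2.2.2)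
      (v, a, c, h) := by
  have hq (w) := (continuous_heightForm_parameters e w).continuousAt (x := (v, a, c, h))
  refine Filter.Tendsto.sub ?_ ?_
  · refine (ENNReal.tendsto_toReal (measure_ne_top _ _)).comp
      (tendsto_measure_of_ae_tendsto_indicator_of_isFiniteMeasure _
        (isOpen_lt continuous_const (continuous_heightForm e v a c h)).measurableSet
        (fun q => (isOpen_lt continuous_const (continuous_heightForm _ _ _ _ _)).measurableSet) ?_)
    filter_upwards [hne] with w hw
    rcases hw.lt_or_gt with h1 | h1
    · filter_upwards [(hq w).eventually_lt_const h1] with q h2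
      simp [h1.not_gt, h2.not_gt]
    · filter_upwards [(hq w).eventually_const_lt h1] with q h2
      simp [h1, h2]
  · refine (ENNReal.tendsto_toReal (measure_ne_top _ _)).comp
      (tendsto_measure_of_ae_tendsto_indicator_of_isFiniteMeasure _
        (isOpen_lt (continuous_heightForm e v a c h) continuous_const).measurableSet
        (fun q => (isOpen_lt (continuous_heightForm _ _ _ _ _) continuous_const).measurableSet) ?_)
    filter_upwards [hne] with w hw
    rcases hw.lt_or_gt with h1 | h1
    · filter_upwards [(hq w).eventually_lt_const h1] with q h2
      simp [h1, h2]
    · filter_upwards [(hq w).eventually_const_lt h1] with q h2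
      simp [h1.not_gt, h2.not_gt]

lemma continuousAt_balance_interpolation {μ : Measure (E × Metric.sphere (0 : E) 1)}
    [IsFiniteMeasure μ]
    (hac : μ ≪ (volume : Measure E).prod (volume : Measure E).toSphere) {e v : E}
    (he : ‖e‖ = 1) (hv : ‖v‖ = 1) (hve : ⟪v, e⟫ = 0) (c τ : ℝ) :
    ContinuousAt (fun q : E × ℝ × ℝ => balance μ e q.1 ((1 - |q.2.2|) * (1 - q.2.1))
      ((1 - |q.2.2|) * q.2.1) q.2.2) (v, c, τ) := by
  have hne : ((1 - |τ|) * (1 - c), (1 - |τ|) * c, τ) ≠ 0 := by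
    intro h
    simp only [Prod.mk_eq_zero] at h
    obtain ⟨h1, h2, rfl⟩ := h
    simp only [abs_zero, sub_zero, one_mul] at h1 h2
    linarith
  have h1 := continuousAt_balance (hac.ae_le (ae_heightForm_ne_zero he hv hve hne))
  have h2 : Continuous fun q : E × ℝ × ℝ =>
      ((q.1, (1 - |q.2.2|) * (1 - q.2.1), (1 - |q.2.2|) * q.2.1, q.2.2) : E × ℝ × ℝ × ℝ) := by
    fun_prop
  exact ContinuousAt.comp (f := fun q : E × ℝ × ℝ =>
    ((q.1, (1 - |q.2.2|) * (1 - q.2.1), (1 - |q.2.2|) * q.2.1, q.2.2) : E × ℝ × ℝ × ℝ))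
    (x := (v, c, τ)) h1 h2.continuousAt

/-- The balances of `N + 1` measures on the lines of an `N + 1`-dimensional space are
simultaneously as small as desired for suitable parameters. -/
lemma exists_balance_eq_mul {N : ℕ} [Fact (Module.finrank ℝ E = N + 1)] (hN : 0 < N)
    {μ : Fin (N + 1) → Measure (E × Metric.sphere (0 : E) 1)} [∀ i, IsFiniteMeasure (μ i)]
    (hac : ∀ i, μ i ≪ (volume : Measure E).prod (volume : Measure E).toSphere) {e : E}
    (he : ‖e‖ = 1) {ε : ℝ} (hε : 0 < ε) :
    ∃ v : E, ‖v‖ = 1 ∧ ⟪v, e⟫ = 0 ∧ ∃ c ∈ Set.Icc (0 : ℝ) 1, ∃ τ ∈ Set.Icc (-1 : ℝ) 1,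
      ∀ i, balance (μ i) e v ((1 - |τ|) * (1 - c)) ((1 - |τ|) * c) τ = ε * τ := by
  have he0 : e ≠ 0 := by
    rintro rfl
    simp at he
  let J : (Fin N → ℝ) ≃L[ℝ] (ℝ ∙ e)ᗮ := ContinuousLinearEquiv.ofFinrankEq (by
    rw [Module.finrank_fin_fun, Submodule.finrank_orthogonal_span_singleton (n := N) he0])
  let v : (Fin N → ℝ) → E := fun x => ‖J x‖⁻¹ • (J x : E)
  have hJ0 {x} (hx : x ≠ 0) : ‖J x‖ ≠ 0 := by simpa using hx
  have hv {x} (hx : x ≠ 0) : ‖v x‖ = 1 := by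
    simp only [v, norm_smul, norm_inv, norm_norm, Submodule.norm_coe]
    exact inv_mul_cancel₀ (hJ0 hx)
  have hve (x) : ⟪v x, e⟫ = 0 := by
    simp only [v, real_inner_smul_left]
    rw [Submodule.mem_orthogonal_singleton_iff_inner_left.1 (J x).2, mul_zero]
  have hvneg (x) : v (-x) = -v x := by simp [v]
  have hvc {x} (hx : x ≠ 0) : ContinuousAt v x := by
    have h1 : ContinuousAt (fun x => ‖J x‖) x := by fun_prop
    have h2 : ContinuousAt (fun x => (J x : E)) x := by fun_prop
    exact (h1.inv₀ (hJ0 hx)).smul h2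
  let c : (Fin N → ℝ) → ℝ := fun x => max (‖x‖ - 1) 0
  have hcc : Continuous c := by fun_prop
  obtain ⟨x, hx, hx2, τ, hτ, h⟩ := exists_common_value_of_even_of_odd hN
    (Ψ := fun i x τ => balance (μ i) e (v x) ((1 - |τ|) * (1 - c x)) ((1 - |τ|) * c x) τ)
    (fun i τ _ x hx => ContinuousAt.continuousWithinAt <|
      (continuousAt_balance_interpolation (hac i) he (hv hx) (hve x) (c x) τ).comp
        (f := fun x => (v x, c x, τ))
        ((hvc hx).prodMk (hcc.continuousAt.prodMk continuousAt_const)))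
    (fun i x hx τ _ => ContinuousAt.continuousWithinAt <|
      (continuousAt_balance_interpolation (hac i) he (hv hx) (hve x) (c x) τ).comp
        (f := fun τ => (v x, c x, τ))
        (continuousAt_const.prodMk (continuousAt_const.prodMk continuousAt_id)))
    (fun i x _ => balance_antitoneOn _ _ _ _ _)
    (fun i x _ => by simp [balance_bot])
    (fun i x _ => by simp [balance_top])
    (fun i x τ hx => by
      have h1 : c x = 0 := max_eq_right (by linarith)
      have h2 : c (-x) = 0 := max_eq_right (by rw [norm_neg]; linarith)
      simp only [h1, h2, hvneg, mul_zero, balance_neg_even])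
    (fun i x τ hx => by
      have h1 : c x = 1 := by simp only [c, hx]; norm_num
      have h2 : c (-x) = 1 := by simp only [c, norm_neg, hx]; norm_num
      simp only [h1, h2, hvneg, abs_neg, sub_self, mul_zero, balance_neg_odd]) hε
  exact ⟨v x, hv hx, hve x, c x, ⟨le_max_right _ _, max_le (by linarith) zero_le_one⟩, τ, hτ, h⟩

theorem exists_balance_eq_zero {N : ℕ} [Fact (Module.finrank ℝ E = N + 1)] (hN : 0 < N)
    {μ : Fin (N + 1) → Measure (E × Metric.sphere (0 : E) 1)} [∀ i, IsFiniteMeasure (μ i)]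
    (hac : ∀ i, μ i ≪ (volume : Measure E).prod (volume : Measure E).toSphere) {e : E}
    (he : ‖e‖ = 1) :
    ∃ v : E, ‖v‖ = 1 ∧ ⟪v, e⟫ = 0 ∧ ∃ c ∈ Set.Icc (0 : ℝ) 1, ∃ τ ∈ Set.Icc (-1 : ℝ) 1,
      ∀ i, balance (μ i) e v ((1 - |τ|) * (1 - c)) ((1 - |τ|) * c) τ = 0 := by
  let K : Set (E × ℝ × ℝ) :=
    (Metric.sphere 0 1 ∩ {v | ⟪v, e⟫ = 0}) ×ˢ Set.Icc 0 1 ×ˢ Set.Icc (-1) 1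
  let f : E × ℝ × ℝ → ℝ := fun q => ∑ i, |balance (μ i) e q.1 ((1 - |q.2.2|) * (1 - q.2.1))
      ((1 - |q.2.2|) * q.2.1) q.2.2|
  have hK : IsCompact K := ((isCompact_sphere _ _).inter_right
    (isClosed_eq (by fun_prop) continuous_const)).prod (isCompact_Icc.prod isCompact_Icc)
  have hf : ContinuousOn f K := by
    rintro ⟨v, c, τ⟩ ⟨⟨hv, hve⟩, -⟩
    refine ContinuousAt.continuousWithinAt (tendsto_finsetSum _ fun i _ => ?_)
    exact (continuousAt_balance_interpolation (hac i) he (mem_sphere_zero_iff_norm.1 hv) hve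
      c τ).abs
  have hsmall {ε : ℝ} (hε : 0 < ε) : ∃ q ∈ K, f q ≤ (N + 1) * ε := by
    obtain ⟨v, hv, hve, c, hc, τ, hτ, h⟩ := exists_balance_eq_mul hN hac he hε
    refine ⟨(v, c, τ), ⟨⟨mem_sphere_zero_iff_norm.2 hv, hve⟩, hc, hτ⟩, ?_⟩
    have h1 : |ε * τ| ≤ ε := by
      rw [abs_mul, abs_of_pos hε]
      exact mul_le_of_le_one_right hε.le (abs_le.2 hτ)
    calc f (v, c, τ) = ∑ i : Fin (N + 1), |ε * τ| := Finset.sum_congr rfl fun i _ => by rw [h i]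
      _ = (N + 1) * |ε * τ| := by simp
      _ ≤ (N + 1) * ε := by gcongr
  obtain ⟨q₁, hq₁, -⟩ := hsmall one_pos
  obtain ⟨⟨v, c, τ⟩, hq, hmin⟩ := hK.exists_isMinOn ⟨q₁, hq₁⟩ hf
  have hle : f (v, c, τ) ≤ 0 := by
    refine le_of_forall_pos_le_add fun δ hδ => ?_
    have hN1 : (0 : ℝ) < N + 1 := by positivity
    obtain ⟨q, hqK, hqf⟩ := hsmall (div_pos hδ hN1)
    rw [mul_div_cancel₀ _ hN1.ne'] at hqf
    linarith [isMinOn_iff.1 hmin q hqK]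
  have h0 := (Finset.sum_eq_zero_iff_of_nonneg fun i _ => abs_nonneg _).1
    (hle.antisymm (Finset.sum_nonneg fun i _ => abs_nonneg _))
  exact ⟨v, mem_sphere_zero_iff_norm.1 hq.1.1, hq.1.2, c, hq.2.1, τ, hq.2.2,
    fun i => abs_eq_zero.1 (h0 i (Finset.mem_univ i))⟩

end LineMeasures

/-- Bisecting `d` mass assignments induced by measures on lines with a horizontal
`(d-2)`-dimensional subspace of a vertical hyperplane.  A line of `ℝ^d` is encoded as a pair
`(p, u) ∈ ℝ^d × S^{d-1}`; each of the `d` given finite measures on this space of lines is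
absolutely continuous with respect to the product of the Lebesgue measure and the spherical
measure.  Either all the measures share a median vertical speed in some horizontal direction
`v` (case (a)), or there are a vertical hyperplane `S_{d-1} = {x : ⟪x,v⟫ = c}` (with `v` a
horizontal unit vector) and a height `h` such that the horizontal subspace of `S_{d-1}` at
height `h` bisects each induced measure (case (b)).  The `e_d`-coordinate of the
intersection point of the line `p + ℝu` with `S_{d-1}` is
`⟪p, e_d⟫ + ((c - ⟪p, v⟫)/⟪u, v⟫) * ⟪u, e_d⟫`. -/
theorem horizontal_bisection_of_lines (d : ℕ) (hd : 2 ≤ d)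
    (ed : EuclideanSpace ℝ (Fin d))
    (hed : ed = EuclideanSpace.single (⟨d - 1, by omega⟩ : Fin d) (1 : ℝ))
    (μ : Fin d → Measure (EuclideanSpace ℝ (Fin d) ×
      Metric.sphere (0 : EuclideanSpace ℝ (Fin d)) 1))
    [∀ i, IsFiniteMeasure (μ i)]
    (hac : ∀ i, μ i ≪
      (volume : Measure (EuclideanSpace ℝ (Fin d))).prod
        (volume : Measure (EuclideanSpace ℝ (Fin d))).toSphere) :
    (∃ v : EuclideanSpace ℝ (Fin d), ‖v‖ = 1 ∧ ⟪v, ed⟫ = 0 ∧ ∃ m : ℝ, ∀ i,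
        μ i {pu | ⟪(pu.2 : EuclideanSpace ℝ (Fin d)), v⟫ ≠ 0 ∧
            ⟪(pu.2 : EuclideanSpace ℝ (Fin d)), ed⟫ /
              ⟪(pu.2 : EuclideanSpace ℝ (Fin d)), v⟫ ≤ m}
          = μ i {pu | ⟪(pu.2 : EuclideanSpace ℝ (Fin d)), v⟫ ≠ 0 ∧
            ⟪(pu.2 : EuclideanSpace ℝ (Fin d)), ed⟫ /
              ⟪(pu.2 : EuclideanSpace ℝ (Fin d)), v⟫ ≥ m}) ∨
    (∃ v : EuclideanSpace ℝ (Fin d), ‖v‖ = 1 ∧ ⟪v, ed⟫ = 0 ∧ ∃ c h : ℝ, ∀ i,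
        μ i {pu | ⟪(pu.2 : EuclideanSpace ℝ (Fin d)), v⟫ ≠ 0 ∧
            ⟪pu.1, ed⟫ + ((c - ⟪pu.1, v⟫) / ⟪(pu.2 : EuclideanSpace ℝ (Fin d)), v⟫) *
              ⟪(pu.2 : EuclideanSpace ℝ (Fin d)), ed⟫ ≥ h}
          = μ i {pu | ⟪(pu.2 : EuclideanSpace ℝ (Fin d)), v⟫ ≠ 0 ∧
            ⟪pu.1, ed⟫ + ((c - ⟪pu.1, v⟫) / ⟪(pu.2 : EuclideanSpace ℝ (Fin d)), v⟫) *
              ⟪(pu.2 : EuclideanSpace ℝ (Fin d)), ed⟫ ≤ h}) := by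
  have hed1 : ‖ed‖ = 1 := by simp [hed]
  clear hed
  obtain ⟨N, rfl⟩ : ∃ N, d = N + 1 := ⟨d - 1, by omega⟩
  have : Fact (Module.finrank ℝ (EuclideanSpace ℝ (Fin (N + 1))) = N + 1) :=
    ⟨finrank_euclideanSpace_fin⟩
  obtain ⟨v, hv, hve, c, hc, τ, hτ, h⟩ := exists_balance_eq_zero (by omega) hac hed1
  have hne (i) {a c h : ℝ} (hach : (a, c, h) ≠ 0) : ∀ᵐ w ∂μ i, heightForm ed v a c h w ≠ 0 :=
    (hac i).ae_le (ae_heightForm_ne_zero hed1 hv hve hach)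
  rcases (abs_le.2 hτ).eq_or_lt with hτ1 | hτ1
  · have hnull (i) : μ i {w | ⟪(w.2 : EuclideanSpace ℝ (Fin (N + 1))), v⟫ ≠ 0} = 0 := by
      have := h i
      rcases eq_or_eq_neg_of_abs_eq hτ1 with rfl | rfl
      · simpa [balance_top, measureReal_eq_zero_iff] using this
      · simpa [balance_bot, measureReal_eq_zero_iff] using this
    exact Or.inl ⟨v, hv, hve, 0, fun i => by
      rw [measure_mono_null (fun w hw => hw.1) (hnull i),
        measure_mono_null (fun w hw => hw.1) (hnull i)]⟩
  have hσ : 0 < 1 - |τ| := sub_pos.2 hτ1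
  have hred (i) : balance (μ i) ed v (1 - c) c (τ / (1 - |τ|)) = 0 := by
    rw [← balance_smul _ _ _ hσ, mul_div_cancel₀ _ hσ.ne', h i]
  generalize τ / (1 - |τ|) = r at hred
  rcases hc.2.eq_or_lt with rfl | hc1
  · refine Or.inl ⟨v, hv, hve, r, fun i => ?_⟩
    rw [sub_self] at hred
    refine (measure_ge_eq_measure_le_of_balance_eq_zero (hne i (by simp)) (hred i)
      fun w hw => ?_).symm
    simp only [heightForm]
    field_simp
    ring
  · have ha : 0 < 1 - c := sub_pos.2 hc1
    have hred1 (i) : balance (μ i) ed v 1 (c / (1 - c)) (r / (1 - c)) = 0 := by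
      rw [← balance_smul _ _ _ ha, mul_div_cancel₀ _ ha.ne', mul_div_cancel₀ _ ha.ne', mul_one,
        hred i]
    refine Or.inr ⟨v, hv, hve, c / (1 - c), r / (1 - c), fun i => ?_⟩
    refine measure_ge_eq_measure_le_of_balance_eq_zero (hne i (by simp)) (hred1 i)
      fun w hw => ?_
    simp only [heightForm]
    field_simp
    ring
end
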